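/- arXiv:quant-ph/9609025 — 2 statements merged into one kernel-verified Lean document; each statement's English description precedes it below -/
import Mathlib

section
/- P¹ and the algebras V_α (α ∈ ℝ) are exactly the proper maximal Lie subalgebras of P containing B: each of P¹ and V_α is a Lie subalgebra of P containing B which is proper (≠ P) and maximal (every Lie subalgebra of P strictly containing it equals P); and conversely, every proper maximal Lie subalgebra of P containing B is equal to P¹ or to V_α for some α ∈ ℝ. -/
noncomputable section

open Complex

/-- Partial derivative in the first (angle) variable. -/
def pdTheta (f : ℝ × ℝ → ℝ) : ℝ × ℝ → ℝ := fun p => deriv (fun t => f (t, p.2)) p.1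

/-- Partial derivative in the second (momentum) variable. -/
def pdEll (f : ℝ × ℝ → ℝ) : ℝ × ℝ → ℝ := fun p => deriv (fun l => f (p.1, l)) p.2

/-- Poisson bracket `{f,g} = f_ℓ g_θ − f_θ g_ℓ`. -/
def pb (f g : ℝ × ℝ → ℝ) : ℝ × ℝ → ℝ :=
  fun p => pdEll f p * pdTheta g p - pdTheta f p * pdEll g p

/-- Spanning set for the polynomial algebra `P`. -/
def PGens : Set (ℝ × ℝ → ℝ) :=
  {h | ∃ r m : ℕ, h = (fun p : ℝ × ℝ => p.2 ^ r * Real.sin (m * p.1)) ∨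
       h = (fun p : ℝ × ℝ => p.2 ^ r * Real.cos (m * p.1))}

/-- The polynomial algebra `P`. -/
def P : Submodule ℝ (ℝ × ℝ → ℝ) := Submodule.span ℝ PGens

def fone : ℝ × ℝ → ℝ := fun _ => 1
def fell : ℝ × ℝ → ℝ := fun p => p.2
def fsin : ℝ × ℝ → ℝ := fun p => Real.sin p.1
def fcos : ℝ × ℝ → ℝ := fun p => Real.cos p.1

lemma fone_mem_P : fone ∈ P :=
  Submodule.subset_span ⟨0, 0, Or.inr (by funext p; simp [fone])⟩

lemma fell_mem_P : fell ∈ P :=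
  Submodule.subset_span ⟨1, 0, Or.inr (by funext p; simp [fell])⟩

lemma fsin_mem_P : fsin ∈ P :=
  Submodule.subset_span ⟨0, 1, Or.inl (by funext p; simp [fsin])⟩

lemma fcos_mem_P : fcos ∈ P :=
  Submodule.subset_span ⟨0, 1, Or.inr (by funext p; simp [fcos])⟩

/-- The domain `D = C^∞(S¹,ℂ)`: smooth `2π`-periodic functions. -/
def Dom : Submodule ℂ (ℝ → ℂ) where
  carrier := {ψ | ContDiff ℝ (⊤ : ℕ∞) ψ ∧ ∀ t, ψ (t + 2 * Real.pi) = ψ t}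
  add_mem' := by
    intro a b ha hb
    exact ⟨ha.1.add hb.1, fun t => by simp [Pi.add_apply, ha.2 t, hb.2 t]⟩
  zero_mem' := ⟨contDiff_const, fun t => rfl⟩
  smul_mem' := by
    intro c a ha
    exact ⟨ha.1.const_smul c, fun t => by simp [Pi.smul_apply, ha.2 t]⟩

/-- The `L²` inner product on `D`. -/
def ip (φ ψ : ℝ → ℂ) : ℂ := ∫ t in (0:ℝ)..(2 * Real.pi), (starRingEnd ℂ) (φ t) * ψ t

/-- Symmetric operator on `D`. -/
def SymmetricOp (A : Dom →ₗ[ℂ] Dom) : Prop :=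
  ∀ φ ψ : Dom, ip (A φ : ℝ → ℂ) (ψ : ℝ → ℂ) = ip (φ : ℝ → ℂ) (A ψ : ℝ → ℂ)

/-- An admissible quantization of type (i)′ with parameter ν of a Lie subalgebra
`O ⊆ P` containing the basic set. -/
structure IsQuant (O : Submodule ℝ (ℝ × ℝ → ℝ)) (ν : ℝ)
    (Q : O →ₗ[ℝ] (Dom →ₗ[ℂ] Dom)) : Prop where
  map_bracket : ∀ (f g : O) (h : pb f g ∈ O),
    Q ⟨pb f g, h⟩ = Complex.I • (Q f ∘ₗ Q g - Q g ∘ₗ Q f)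
  map_one : ∀ h : fone ∈ O, Q ⟨fone, h⟩ = LinearMap.id
  symm : ∀ f : O, SymmetricOp (Q f)
  map_ell : ∀ (h : fell ∈ O) (ψ : Dom) (t : ℝ),
    (Q ⟨fell, h⟩ ψ : ℝ → ℂ) t = -Complex.I * deriv (ψ : ℝ → ℂ) t + (ν : ℂ) * (ψ : ℝ → ℂ) t
  map_sin : ∀ (h : fsin ∈ O) (ψ : Dom) (t : ℝ),
    (Q ⟨fsin, h⟩ ψ : ℝ → ℂ) t = (Real.sin t : ℂ) * (ψ : ℝ → ℂ) t
  map_cos : ∀ (h : fcos ∈ O) (ψ : Dom) (t : ℝ),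
    (Q ⟨fcos, h⟩ ψ : ℝ → ℂ) t = (Real.cos t : ℂ) * (ψ : ℝ → ℂ) t

end
noncomputable section
/-- Spanning set of real trigonometric polynomials. -/
def TrigGens : Set (ℝ → ℝ) :=
  {h | ∃ m : ℕ, h = (fun t => Real.sin (m * t)) ∨ h = fun t => Real.cos (m * t)}

/-- Real trigonometric polynomials. -/
def Trig : Submodule ℝ (ℝ → ℝ) := Submodule.span ℝ TrigGens

/-- Spanning set for `P¹`, the elements of `P` of degree at most 1 in `ℓ`. -/
def P1Gens : Set (ℝ × ℝ → ℝ) :=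
  {h | ∃ r m : ℕ, r ≤ 1 ∧
        (h = (fun p : ℝ × ℝ => p.2 ^ r * Real.sin (m * p.1)) ∨
         h = (fun p : ℝ × ℝ => p.2 ^ r * Real.cos (m * p.1)))}

/-- `P¹ ⊆ P`: polynomials affine in the momentum `ℓ`. -/
def P1 : Submodule ℝ (ℝ × ℝ → ℝ) := Submodule.span ℝ P1Gens

lemma fone_mem_P1 : fone ∈ P1 :=
  Submodule.subset_span ⟨0, 0, Nat.zero_le 1, Or.inr (by funext p; simp [fone])⟩
lemma fell_mem_P1 : fell ∈ P1 :=
  Submodule.subset_span ⟨1, 0, le_refl 1, Or.inr (by funext p; simp [fell])⟩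
lemma fsin_mem_P1 : fsin ∈ P1 :=
  Submodule.subset_span ⟨0, 1, Nat.zero_le 1, Or.inl (by funext p; simp [fsin])⟩
lemma fcos_mem_P1 : fcos ∈ P1 :=
  Submodule.subset_span ⟨0, 1, Nat.zero_le 1, Or.inr (by funext p; simp [fcos])⟩
end
noncomputable section
/-- Partial θ-derivative of a complex-valued function. -/
def pdThetaC (f : ℝ × ℝ → ℂ) : ℝ × ℝ → ℂ := fun p => deriv (fun t => f (t, p.2)) p.1
/-- Partial ℓ-derivative of a complex-valued function. -/
def pdEllC (f : ℝ × ℝ → ℂ) : ℝ × ℝ → ℂ := fun p => deriv (fun l => f (p.1, l)) p.2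
/-- Poisson bracket of complex-valued functions. -/
def pbC (f g : ℝ × ℝ → ℂ) : ℝ × ℝ → ℂ :=
  fun p => pdEllC f p * pdThetaC g p - pdThetaC f p * pdEllC g p

/-- `e^r_m = ℓ^r e^{imθ}`. -/
def eC (r : ℕ) (m : ℤ) : ℝ × ℝ → ℂ :=
  fun p => (p.2 : ℂ) ^ r * Complex.exp (Complex.I * (m : ℂ) * (p.1 : ℂ))

/-- The complexification `P_ℂ` of `P`. -/
def PC : Submodule ℂ (ℝ × ℝ → ℂ) :=
  Submodule.span ℂ {h | ∃ (r : ℕ) (m : ℤ), h = eC r m}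

/-- Closure under the Poisson bracket (complex case). -/
def IsLieSubC (S : Submodule ℂ (ℝ × ℝ → ℂ)) : Prop :=
  ∀ f g : ℝ × ℝ → ℂ, f ∈ S → g ∈ S → pbC f g ∈ S

/-- The generators of `W_α`: `1, e^0_1, e^0_{−1}, e^1_0` and
`e^2_{2N+1} + 2α e^1_{2N+1}` for all `N ∈ ℤ`. -/
def WGens (α : ℝ) : Set (ℝ × ℝ → ℂ) :=
  {fun _ => 1, eC 0 1, eC 0 (-1), eC 1 0} ∪
    {h | ∃ N : ℤ, h = eC 2 (2 * N + 1) + (2 * α : ℂ) • eC 1 (2 * N + 1)}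

/-- `W_α`: the smallest complex Lie subalgebra of `P_ℂ` containing the generators. -/
def W (α : ℝ) : Submodule ℂ (ℝ × ℝ → ℂ) :=
  sInf {S | S ≤ PC ∧ WGens α ⊆ S ∧ IsLieSubC S}

/-- The complexification of a real-valued function. -/
def cplx (f : ℝ × ℝ → ℝ) : ℝ × ℝ → ℂ := fun p => (f p : ℂ)

/-- `V_α`: the real elements of `W_α`, a real Lie subalgebra of `P`. -/
def V (α : ℝ) : Submodule ℝ (ℝ × ℝ → ℝ) where
  carrier := {f | cplx f ∈ W α}
  add_mem' := by
    intro a b ha hb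
    simp only [Set.mem_setOf_eq] at *
    have h : cplx (a + b) = cplx a + cplx b := by
      funext p; simp [cplx]
    rw [h]; exact add_mem ha hb
  zero_mem' := by
    simp only [Set.mem_setOf_eq]
    have h : cplx (0 : ℝ × ℝ → ℝ) = 0 := by funext p; simp [cplx]
    rw [h]; exact zero_mem _
  smul_mem' := by
    intro c a ha
    simp only [Set.mem_setOf_eq] at *
    have h : cplx (c • a) = (c : ℂ) • cplx a := by
      funext p; simp [cplx]
    rw [h]; exact Submodule.smul_mem _ _ ha
end
noncomputable section
/-- The basic set `B = span{1, ℓ, sin θ, cos θ}`. -/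
def Bsub : Submodule ℝ (ℝ × ℝ → ℝ) := Submodule.span ℝ {fone, fell, fsin, fcos}

/-- Closure under the Poisson bracket. -/
def IsLieSub (S : Submodule ℝ (ℝ × ℝ → ℝ)) : Prop :=
  ∀ f g : ℝ × ℝ → ℝ, f ∈ S → g ∈ S → pb f g ∈ S


open Polynomial

/-- Differentiability in each variable. -/
def DC (f : ℝ × ℝ → ℂ) : Prop := ∀ p : ℝ × ℝ,
  DifferentiableAt ℝ (fun t => f (t, p.2)) p.1 ∧ DifferentiableAt ℝ (fun l => f (p.1, l)) p.2

def DR (f : ℝ × ℝ → ℝ) : Prop := ∀ p : ℝ × ℝ,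
  DifferentiableAt ℝ (fun t => f (t, p.2)) p.1 ∧ DifferentiableAt ℝ (fun l => f (p.1, l)) p.2

/-- `E m f = f(ℓ) e^{imθ}`. -/
def E (m : ℤ) : ℂ[X] →ₗ[ℂ] (ℝ × ℝ → ℂ) where
  toFun f := fun p => f.eval (p.2 : ℂ) * Complex.exp (Complex.I * (m : ℂ) * (p.1 : ℂ))
  map_add' := by intro f g; funext p; simp [add_mul]
  map_smul' := by intro c f; funext p; simp [mul_assoc]

lemma E_apply (m : ℤ) (f : ℂ[X]) (p : ℝ × ℝ) :
    E m f p = f.eval (p.2 : ℂ) * Complex.exp (Complex.I * (m : ℂ) * (p.1 : ℂ)) := rfl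

lemma eC_eq (r : ℕ) (m : ℤ) : eC r m = E m (X ^ r) := by
  funext p; simp [eC, E_apply]

lemma E_hasDerivAt_theta (m : ℤ) (f : ℂ[X]) (p : ℝ × ℝ) :
    HasDerivAt (fun t : ℝ => E m f (t, p.2)) (Complex.I * m * E m f p) p.1 := by
  simp only [E_apply]
  have h1 : HasDerivAt (fun t : ℝ => Complex.I * (m : ℂ) * (t : ℂ)) (Complex.I * m * 1) p.1 :=
    (Complex.ofRealCLM.hasDerivAt (x := p.1)).const_mul _
  have h2 := (h1.cexp).const_mul (f.eval (p.2 : ℂ))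
  refine h2.congr_deriv ?_
  ring

lemma E_hasDerivAt_ell (m : ℤ) (f : ℂ[X]) (p : ℝ × ℝ) :
    HasDerivAt (fun l : ℝ => E m f (p.1, l)) (E m (derivative f) p) p.2 := by
  simp only [E_apply]
  have h1 : HasDerivAt (fun l : ℝ => f.eval (l : ℂ)) ((derivative f).eval (p.2 : ℂ)) p.2 :=
    (f.hasDerivAt (p.2 : ℂ)).comp_ofReal
  exact h1.mul_const _

lemma E_DC (m : ℤ) (f : ℂ[X]) : DC (E m f) := fun p =>
  ⟨(E_hasDerivAt_theta m f p).differentiableAt, (E_hasDerivAt_ell m f p).differentiableAt⟩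

lemma pbC_E (m n : ℤ) (f g : ℂ[X]) :
    pbC (E m f) (E n g) =
      Complex.I • E (m + n) (C (n : ℂ) * (derivative f * g) - C (m : ℂ) * (f * derivative g)) := by
  funext p
  simp only [pbC, pdEllC, pdThetaC, (E_hasDerivAt_theta _ _ _).deriv,
    (E_hasDerivAt_ell _ _ _).deriv]
  simp only [E_apply, Pi.smul_apply, smul_eq_mul, eval_sub, eval_mul, eval_C]
  have : Complex.exp (Complex.I * ((m + n : ℤ) : ℂ) * (p.1 : ℂ)) =
      Complex.exp (Complex.I * (m : ℂ) * (p.1 : ℂ)) * Complex.exp (Complex.I * (n : ℂ) * (p.1 : ℂ)) := by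
    rw [← Complex.exp_add]; congr 1; push_cast; ring
  rw [this]; ring

lemma DC_add {f g : ℝ × ℝ → ℂ} (hf : DC f) (hg : DC g) : DC (f + g) := fun p =>
  ⟨(hf p).1.add (hg p).1, (hf p).2.add (hg p).2⟩

lemma DC_zero : DC 0 := fun _ => ⟨differentiableAt_const _, differentiableAt_const _⟩

lemma DC_smul {f : ℝ × ℝ → ℂ} (c : ℂ) (hf : DC f) : DC (c • f) := fun p =>
  ⟨(hf p).1.const_smul c, (hf p).2.const_smul c⟩

lemma DR_add {f g : ℝ × ℝ → ℝ} (hf : DR f) (hg : DR g) : DR (f + g) := fun p =>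
  ⟨(hf p).1.add (hg p).1, (hf p).2.add (hg p).2⟩

lemma DR_smul {f : ℝ × ℝ → ℝ} (c : ℝ) (hf : DR f) : DR (c • f) := fun p =>
  ⟨(hf p).1.const_smul c, (hf p).2.const_smul c⟩

lemma DR_P {f : ℝ × ℝ → ℝ} (hf : f ∈ P) : DR f := by
  refine Submodule.span_induction (p := fun f _ => DR f) ?_ ?_ ?_ ?_ hf
  · rintro h ⟨r, m, rfl | rfl⟩ p
    · constructor <;> fun_prop
    · constructor <;> fun_prop
  · exact fun _ => ⟨differentiableAt_const _, differentiableAt_const _⟩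
  · intro f g _ _ hf hg; exact DR_add hf hg
  · intro c f _ hf; exact DR_smul c hf

lemma pbC_add_left {f g h : ℝ × ℝ → ℂ} (hf : DC f) (hg : DC g) :
    pbC (f + g) h = pbC f h + pbC g h := by
  funext p
  have h1 : pdThetaC (f + g) p = pdThetaC f p + pdThetaC g p := deriv_add (hf p).1 (hg p).1
  have h2 : pdEllC (f + g) p = pdEllC f p + pdEllC g p := deriv_add (hf p).2 (hg p).2
  simp only [pbC, Pi.add_apply, h1, h2]; ring

lemma pbC_smul_left {f h : ℝ × ℝ → ℂ} (c : ℂ) (hf : DC f) :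
    pbC (c • f) h = c • pbC f h := by
  funext p
  have h1 : pdThetaC (c • f) p = c * pdThetaC f p := deriv_const_smul c (hf p).1
  have h2 : pdEllC (c • f) p = c * pdEllC f p := deriv_const_smul c (hf p).2
  simp only [pbC, Pi.smul_apply, smul_eq_mul, h1, h2]; ring

lemma pbC_anti (f g : ℝ × ℝ → ℂ) : pbC f g = - pbC g f := by
  funext p; simp only [pbC, Pi.neg_apply]; ring

lemma pbC_zero_left (h : ℝ × ℝ → ℂ) : pbC 0 h = 0 := by
  have := pbC_smul_left (h := h) 0 DC_zero
  simpa using this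

/-- span of a family of `E m f`. -/
def Esp (A : Set (ℤ × ℂ[X])) : Submodule ℂ (ℝ × ℝ → ℂ) :=
  Submodule.span ℂ ((fun a : ℤ × ℂ[X] => E a.1 a.2) '' A)

lemma Esp_DC {A : Set (ℤ × ℂ[X])} {f : ℝ × ℝ → ℂ} (hf : f ∈ Esp A) : DC f := by
  refine Submodule.span_induction (p := fun f _ => DC f) ?_ DC_zero ?_ ?_ hf
  · rintro _ ⟨a, _, rfl⟩; exact E_DC _ _
  · intro f g _ _ hf hg; exact DC_add hf hg
  · intro c f _ hf; exact DC_smul c hf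

lemma Esp_lie {A : Set (ℤ × ℂ[X])}
    (h : ∀ a ∈ A, ∀ b ∈ A, E (a.1 + b.1) (C (b.1 : ℂ) * (derivative a.2 * b.2)
      - C (a.1 : ℂ) * (a.2 * derivative b.2)) ∈ Esp A) : IsLieSubC (Esp A) := by
  have key : ∀ b ∈ A, ∀ f ∈ Esp A, pbC f (E b.1 b.2) ∈ Esp A := by
    intro b hb f hf
    refine Submodule.span_induction (p := fun f _ => pbC f (E b.1 b.2) ∈ Esp A) ?_ ?_ ?_ ?_ hf
    · rintro _ ⟨a, ha, rfl⟩
      rw [pbC_E]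
      exact Submodule.smul_mem _ _ (h a ha b hb)
    · rw [pbC_zero_left]; exact zero_mem _
    · intro f g hf hg h1 h2
      rw [pbC_add_left (Esp_DC hf) (Esp_DC hg)]; exact add_mem h1 h2
    · intro c f hf h1
      rw [pbC_smul_left c (Esp_DC hf)]; exact Submodule.smul_mem _ _ h1
  intro f g hf hg
  rw [pbC_anti]
  refine neg_mem ?_
  refine Submodule.span_induction (p := fun g _ => pbC g f ∈ Esp A) ?_ ?_ ?_ ?_ hg
  · rintro _ ⟨b, hb, rfl⟩
    rw [pbC_anti]
    exact neg_mem (key b hb f hf)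
  · rw [pbC_zero_left]; exact zero_mem _
  · intro f g hf hg h1 h2
    rw [pbC_add_left (Esp_DC hf) (Esp_DC hg)]; exact add_mem h1 h2
  · intro c f hf h1
    rw [pbC_smul_left c (Esp_DC hf)]; exact Submodule.smul_mem _ _ h1

lemma E_mem_PC (m : ℤ) (f : ℂ[X]) : E m f ∈ PC := by
  induction f using Polynomial.induction_on' with
  | add p q hp hq => rw [map_add]; exact add_mem hp hq
  | monomial n a =>
    have : E m (monomial n a) = a • eC n m := by
      rw [eC_eq, ← map_smul, smul_X_eq_monomial]
    rw [this]
    exact Submodule.smul_mem _ _ (Submodule.subset_span ⟨n, m, rfl⟩)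

lemma Esp_le_PC (A : Set (ℤ × ℂ[X])) : Esp A ≤ PC := by
  rw [Esp, Submodule.span_le]
  rintro _ ⟨a, _, rfl⟩
  exact E_mem_PC _ _

lemma PC_eq : PC = Esp Set.univ := by
  refine le_antisymm ?_ (Esp_le_PC _)
  rw [PC, Submodule.span_le]
  rintro _ ⟨r, m, rfl⟩
  rw [eC_eq]
  exact Submodule.subset_span ⟨(m, X ^ r), trivial, rfl⟩

lemma PC_DC {f : ℝ × ℝ → ℂ} (hf : f ∈ PC) : DC f := by
  rw [PC_eq] at hf; exact Esp_DC hf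

lemma PC_lie : IsLieSubC PC := by
  rw [PC_eq]
  refine Esp_lie fun a _ b _ => Submodule.subset_span ⟨(_, _), trivial, rfl⟩

lemma PC_sum {h : ℝ × ℝ → ℂ} (hh : h ∈ PC) :
    ∃ (s : Finset ℤ) (f : ℤ → ℂ[X]), h = ∑ m ∈ s, E m (f m) := by
  have : PC ≤ LinearMap.range (Finsupp.lsum ℂ (fun m : ℤ => E m)) := by
    rw [PC, Submodule.span_le]
    rintro _ ⟨r, m, rfl⟩
    exact ⟨Finsupp.single m (X ^ r), by simp [eC_eq]⟩
  obtain ⟨f, hf⟩ := this hh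
  exact ⟨f.support, f, by rw [← hf]; simp [Finsupp.sum]⟩

/-- Real `S`, complexified. -/
def Cx (S : Submodule ℝ (ℝ × ℝ → ℝ)) : Submodule ℂ (ℝ × ℝ → ℂ) where
  carrier := {f | (fun p => (f p).re) ∈ S ∧ (fun p => (f p).im) ∈ S}
  add_mem' := by
    rintro a b ⟨h1, h2⟩ ⟨h3, h4⟩
    exact ⟨add_mem h1 h3, add_mem h2 h4⟩
  zero_mem' := ⟨S.zero_mem, S.zero_mem⟩
  smul_mem' := by
    rintro c a ⟨h1, h2⟩
    refine ⟨?_, ?_⟩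
    · have := sub_mem (S.smul_mem c.re h1) (S.smul_mem c.im h2)
      convert this using 1
      funext p; simp
    · have := add_mem (S.smul_mem c.re h2) (S.smul_mem c.im h1)
      convert this using 1
      funext p; simp

lemma mem_Cx {S : Submodule ℝ (ℝ × ℝ → ℝ)} {f : ℝ × ℝ → ℂ} :
    f ∈ Cx S ↔ (fun p => (f p).re) ∈ S ∧ (fun p => (f p).im) ∈ S := Iff.rfl

lemma cplx_mem_Cx {S : Submodule ℝ (ℝ × ℝ → ℝ)} {f : ℝ × ℝ → ℝ} :
    cplx f ∈ Cx S ↔ f ∈ S := by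
  rw [mem_Cx]
  constructor
  · intro h; simpa [cplx] using h.1
  · intro h
    refine ⟨by simpa [cplx] using h, ?_⟩
    exact S.zero_mem

lemma Cx_mono {S T : Submodule ℝ (ℝ × ℝ → ℝ)} (h : S ≤ T) : Cx S ≤ Cx T :=
  fun _ hf => ⟨h hf.1, h hf.2⟩

lemma Cx_conj {S : Submodule ℝ (ℝ × ℝ → ℝ)} {f : ℝ × ℝ → ℂ} (hf : f ∈ Cx S) :
    (fun p => (starRingEnd ℂ) (f p)) ∈ Cx S := by
  refine ⟨by simpa using hf.1, ?_⟩
  exact neg_mem hf.2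

lemma pd_theta_split {f : ℝ × ℝ → ℂ} (h1 : DR (fun p => (f p).re)) (h2 : DR (fun p => (f p).im))
    (p : ℝ × ℝ) : pdThetaC f p =
      (pdTheta (fun p => (f p).re) p : ℂ) + Complex.I * (pdTheta (fun p => (f p).im) p : ℂ) := by
  have a := ((h1 p).1.hasDerivAt).ofReal_comp
  have b := (((h2 p).1.hasDerivAt).ofReal_comp).const_mul Complex.I
  have c := (a.add b).deriv
  rw [pdTheta, pdTheta, ← c, pdThetaC]
  congr 1
  funext t
  simp only [Pi.add_apply]
  rw [mul_comm, Complex.re_add_im]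

lemma pd_ell_split {f : ℝ × ℝ → ℂ} (h1 : DR (fun p => (f p).re)) (h2 : DR (fun p => (f p).im))
    (p : ℝ × ℝ) : pdEllC f p =
      (pdEll (fun p => (f p).re) p : ℂ) + Complex.I * (pdEll (fun p => (f p).im) p : ℂ) := by
  have a := ((h1 p).2.hasDerivAt).ofReal_comp
  have b := (((h2 p).2.hasDerivAt).ofReal_comp).const_mul Complex.I
  have c := (a.add b).deriv
  rw [pdEll, pdEll, ← c, pdEllC]
  congr 1
  funext t
  simp only [Pi.add_apply]
  rw [mul_comm, Complex.re_add_im]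

lemma Cx_lie {S : Submodule ℝ (ℝ × ℝ → ℝ)} (hS : IsLieSub S) (hP : S ≤ P) : IsLieSubC (Cx S) := by
  rintro f g ⟨f1, f2⟩ ⟨g1, g2⟩
  have F1 := DR_P (hP f1)
  have F2 := DR_P (hP f2)
  have G1 := DR_P (hP g1)
  have G2 := DR_P (hP g2)
  refine ⟨?_, ?_⟩
  · convert sub_mem (hS _ _ f1 g1) (hS _ _ f2 g2) using 1
    funext p
    simp only [pbC, pd_theta_split F1 F2, pd_theta_split G1 G2, pd_ell_split F1 F2,
      pd_ell_split G1 G2, Pi.sub_apply, pb]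
    simp; ring
  · convert add_mem (hS _ _ f1 g2) (hS _ _ f2 g1) using 1
    funext p
    simp only [pbC, pd_theta_split F1 F2, pd_theta_split G1 G2, pd_ell_split F1 F2,
      pd_ell_split G1 G2, Pi.add_apply, pb]
    simp; ring

lemma cplx_pb {f g : ℝ × ℝ → ℝ} (hf : DR f) (hg : DR g) :
    cplx (pb f g) = pbC (cplx f) (cplx g) := by
  have z : DR (fun _ => (0 : ℝ)) := fun _ => ⟨differentiableAt_const _, differentiableAt_const _⟩
  have aux : ∀ {f : ℝ × ℝ → ℝ}, DR f → ∀ p, pdThetaC (cplx f) p = pdTheta f p ∧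
      pdEllC (cplx f) p = pdEll f p := by
    intro f hf p
    exact ⟨((hf p).1.hasDerivAt).ofReal_comp.deriv, ((hf p).2.hasDerivAt).ofReal_comp.deriv⟩
  funext p
  simp only [pbC, (aux hf p).1, (aux hf p).2, (aux hg p).1, (aux hg p).2, cplx, pb]
  push_cast; ring

lemma exp_int (m : ℤ) (t : ℝ) : Complex.exp (Complex.I * (m : ℂ) * (t : ℂ)) =
    (Real.cos (m * t) : ℂ) + Complex.I * (Real.sin (m * t) : ℂ) := by
  rw [show Complex.I * (m : ℂ) * (t : ℂ) = ((m * t : ℝ) : ℂ) * Complex.I by push_cast; ring,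
    Complex.exp_mul_I]
  push_cast; ring

lemma E_XR (r : ℕ) (m : ℤ) : E m (X ^ r) =
    cplx (fun p => p.2 ^ r * Real.cos (m * p.1)) +
      Complex.I • cplx (fun p => p.2 ^ r * Real.sin (m * p.1)) := by
  funext p
  simp only [E_apply, exp_int, cplx, Pi.add_apply, Pi.smul_apply, smul_eq_mul]
  push_cast; simp; ring

/-- If real cos/sin generators lie in `S` for naturals then the complex ones lie in `Cx S`. -/
lemma E_mem_Cx_of {S : Submodule ℝ (ℝ × ℝ → ℝ)} (r : ℕ) (m : ℤ)
    (hc : ∀ n : ℕ, (fun p : ℝ × ℝ => p.2 ^ r * Real.cos (n * p.1)) ∈ S)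
    (hs : ∀ n : ℕ, (fun p : ℝ × ℝ => p.2 ^ r * Real.sin (n * p.1)) ∈ S) : E m (X ^ r) ∈ Cx S := by
  rw [E_XR]
  refine add_mem (cplx_mem_Cx.2 ?_) (Submodule.smul_mem _ _ (cplx_mem_Cx.2 ?_))
  · rcases Int.eq_nat_or_neg m with ⟨n, rfl | rfl⟩
    · simpa using hc n
    · simpa using hc n
  · rcases Int.eq_nat_or_neg m with ⟨n, rfl | rfl⟩
    · simpa using hs n
    · have := neg_mem (hs n)
      convert this using 1
      funext p; simp

lemma E_poly_mem {L : Submodule ℂ (ℝ × ℝ → ℂ)} (m : ℤ) (d : ℕ)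
    (h : ∀ r ≤ d, E m (X ^ r) ∈ L) (f : ℂ[X]) (hf : f.natDegree ≤ d) : E m f ∈ L := by
  rw [f.as_sum_range_C_mul_X_pow, map_sum]
  refine sum_mem fun i hi => ?_
  rw [← smul_eq_C_mul, map_smul]
  refine Submodule.smul_mem _ _ (h i ?_)
  have := Finset.mem_range.1 hi
  omega

lemma PC_le_Cx_P : PC ≤ Cx P := by
  rw [PC, Submodule.span_le]
  rintro _ ⟨r, m, rfl⟩
  rw [eC_eq]
  exact E_mem_Cx_of r m (fun n => Submodule.subset_span ⟨r, n, Or.inr rfl⟩)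
    (fun n => Submodule.subset_span ⟨r, n, Or.inl rfl⟩)

lemma cplx_cos (r : ℕ) (m : ℤ) : cplx (fun p : ℝ × ℝ => p.2 ^ r * Real.cos (m * p.1)) =
    (1 / 2 : ℂ) • (E m (X ^ r) + E (-m) (X ^ r)) := by
  rw [E_XR, E_XR]
  funext p
  simp [cplx]; ring

lemma cplx_sin (r : ℕ) (m : ℤ) : cplx (fun p : ℝ × ℝ => p.2 ^ r * Real.sin (m * p.1)) =
    (-Complex.I / 2 : ℂ) • (E m (X ^ r) - E (-m) (X ^ r)) := by
  rw [E_XR, E_XR]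
  funext p
  simp [cplx]; ring_nf; simp

lemma cplx_add (f g : ℝ × ℝ → ℝ) : cplx (f + g) = cplx f + cplx g := by funext p; simp [cplx]
lemma cplx_smul (c : ℝ) (f : ℝ × ℝ → ℝ) : cplx (c • f) = (c : ℂ) • cplx f := by
  funext p; simp [cplx]
lemma cplx_zero : cplx 0 = 0 := by funext p; simp [cplx]

/-- Preimage of a complex submodule under `cplx`. -/
def Re' (L : Submodule ℂ (ℝ × ℝ → ℂ)) : Submodule ℝ (ℝ × ℝ → ℝ) where
  carrier := {f | cplx f ∈ L}
  add_mem' := by intro a b ha hb; simp only [Set.mem_ofPred_eq] at *; rw [cplx_add]; exact add_mem ha hb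
  zero_mem' := by simp only [Set.mem_ofPred_eq]; rw [cplx_zero]; exact zero_mem _
  smul_mem' := by
    intro c a ha; simp only [Set.mem_ofPred_eq] at *; rw [cplx_smul]; exact Submodule.smul_mem _ _ ha

lemma cos_sin_mem {L : Submodule ℂ (ℝ × ℝ → ℂ)} {r : ℕ} (h : ∀ m, E m (X ^ r) ∈ L) (n : ℕ) :
    (fun p : ℝ × ℝ => p.2 ^ r * Real.sin (n * p.1)) ∈ Re' L ∧
    (fun p : ℝ × ℝ => p.2 ^ r * Real.cos (n * p.1)) ∈ Re' L := by
  constructor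
  · have := cplx_sin r n
    simp only [Int.cast_natCast] at this
    show cplx _ ∈ L
    rw [this]
    exact Submodule.smul_mem _ _ (sub_mem (h _) (h _))
  · have := cplx_cos r n
    simp only [Int.cast_natCast] at this
    show cplx _ ∈ L
    rw [this]
    exact Submodule.smul_mem _ _ (add_mem (h _) (h _))

lemma P_le_Re {L : Submodule ℂ (ℝ × ℝ → ℂ)} (h : ∀ m r, E m (X ^ r) ∈ L) : P ≤ Re' L := by
  rw [P, Submodule.span_le]
  rintro _ ⟨r, n, rfl | rfl⟩
  · exact (cos_sin_mem (fun m => h m r) n).1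
  · exact (cos_sin_mem (fun m => h m r) n).2

lemma cplx_mem_PC {f : ℝ × ℝ → ℝ} (hf : f ∈ P) : cplx f ∈ PC :=
  P_le_Re (fun m r => E_mem_PC m _) hf

lemma Cx_le_PC {S : Submodule ℝ (ℝ × ℝ → ℝ)} (h : S ≤ P) : Cx S ≤ PC := by
  rintro f ⟨h1, h2⟩
  have := add_mem (cplx_mem_PC (h h1)) (PC.smul_mem Complex.I (cplx_mem_PC (h h2)))
  convert this using 1
  funext p
  simp [cplx, mul_comm Complex.I, Complex.re_add_im]

/-- P1 complexified. -/
def P1C : Submodule ℂ (ℝ × ℝ → ℂ) := Esp {a | a.2.natDegree ≤ 1}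

lemma E_mem_P1C {m : ℤ} {f : ℂ[X]} (hf : f.natDegree ≤ 1) : E m f ∈ P1C :=
  Submodule.subset_span ⟨(m, f), hf, rfl⟩

lemma P1C_lie : IsLieSubC P1C := by
  refine Esp_lie ?_
  rintro ⟨m, f⟩ hf ⟨n, g⟩ hg
  simp only [Set.mem_ofPred_eq] at hf hg
  refine E_mem_P1C ?_
  have df : (derivative f).natDegree ≤ 0 := (natDegree_derivative_le f).trans (by omega)
  have dg : (derivative g).natDegree ≤ 0 := (natDegree_derivative_le g).trans (by omega)
  refine (natDegree_sub_le _ _).trans (max_le ?_ ?_)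
  · refine (natDegree_C_mul_le _ _).trans (natDegree_mul_le.trans ?_)
    simp only; omega
  · refine (natDegree_C_mul_le _ _).trans (natDegree_mul_le.trans ?_)
    simp only; omega

lemma P1C_le : P1C ≤ Cx P1 := by
  rw [P1C, Esp, Submodule.span_le]
  rintro _ ⟨⟨m, f⟩, hf, rfl⟩
  refine E_poly_mem m 1 (fun r hr => ?_) f hf
  exact E_mem_Cx_of r m (fun n => Submodule.subset_span ⟨r, n, hr, Or.inr rfl⟩)
    (fun n => Submodule.subset_span ⟨r, n, hr, Or.inl rfl⟩)

lemma P1_le_Re : P1 ≤ Re' P1C := by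
  rw [P1, Submodule.span_le]
  have h : ∀ r ≤ 1, ∀ m, E m (X ^ r) ∈ P1C := fun r hr m => E_mem_P1C (by simpa using hr)
  rintro _ ⟨r, n, hr, rfl | rfl⟩
  · exact (cos_sin_mem (h r hr) n).1
  · exact (cos_sin_mem (h r hr) n).2

lemma P1_le_P : P1 ≤ P := by
  refine Submodule.span_mono ?_
  rintro _ ⟨r, n, hr, h⟩
  exact ⟨r, n, h⟩

lemma P1_lie : IsLieSub P1 := by
  intro f g hf hg
  rw [← cplx_mem_Cx, cplx_pb (DR_P (P1_le_P hf)) (DR_P (P1_le_P hg))]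
  exact P1C_le (P1C_lie _ _ (P1_le_Re hf) (P1_le_Re hg))

lemma P1_ne_P : P1 ≠ P := by
  intro h
  have h2 : (fun p : ℝ × ℝ => p.2 ^ 2 * Real.cos ((0 : ℕ) * p.1)) ∈ P1 := by
    rw [h]; exact Submodule.subset_span ⟨2, 0, Or.inr rfl⟩
  have key : ∀ f ∈ P1, f (0, 2) - 2 * f (0, 1) + f (0, 0) = 0 := by
    intro f hf
    refine Submodule.span_induction
      (p := fun f _ => f (0, 2) - 2 * f (0, 1) + f (0, 0) = 0) ?_ ?_ ?_ ?_ hf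
    · rintro _ ⟨r, m, hr, rfl | rfl⟩
      · simp
      · interval_cases r <;> norm_num
    · simp
    · intro f g _ _ hf hg; simp only [Pi.add_apply]; linarith
    · intro c f _ hf; simp only [Pi.smul_apply, smul_eq_mul]; linear_combination c * hf
  have := key _ h2
  norm_num at this

lemma B_le {S : Submodule ℝ (ℝ × ℝ → ℝ)} : Bsub ≤ S ↔ fone ∈ S ∧ fell ∈ S ∧ fsin ∈ S ∧ fcos ∈ S := by
  rw [Bsub, Submodule.span_le]
  simp [Set.insert_subset_iff]

lemma conj_E (m : ℤ) (f : ℂ[X]) : (fun p => (starRingEnd ℂ) (E m f p)) =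
    E (-m) (f.map (starRingEnd ℂ)) := by
  funext p
  rw [E_apply, E_apply, map_mul, ← Complex.exp_conj]
  congr 1
  · have := Polynomial.eval_map_apply (starRingEnd ℂ) (p := f) (p.2 : ℂ)
    rw [Complex.conj_ofReal] at this
    exact this.symm
  · congr 1
    simp

lemma E_C_mul (m : ℤ) (c : ℂ) (f : ℂ[X]) : E m (C c * f) = c • E m f := by
  rw [← smul_eq_C_mul, map_smul]

lemma E_C_mul_mem {L : Submodule ℂ (ℝ × ℝ → ℂ)} {m : ℤ} {c : ℂ} {f : ℂ[X]} (hc : c ≠ 0) :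
    E m (C c * f) ∈ L ↔ E m f ∈ L := by
  rw [E_C_mul]; exact Submodule.smul_mem_iff _ hc

lemma brk {L : Submodule ℂ (ℝ × ℝ → ℂ)} (hL : IsLieSubC L) {m n : ℤ} {f g : ℂ[X]}
    (hf : E m f ∈ L) (hg : E n g ∈ L) (k : ℤ) (hk : k = m + n) (q : ℂ[X]) (c : ℂ) (hc : c ≠ 0)
    (h : C (n : ℂ) * (derivative f * g) - C (m : ℂ) * (f * derivative g) = C c * q) :
    E k q ∈ L := by
  have := hL _ _ hf hg
  rw [pbC_E, Submodule.smul_mem_iff _ Complex.I_ne_zero, h, E_C_mul_mem hc] at this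
  rw [hk]; exact this

structure HB (L : Submodule ℂ (ℝ × ℝ → ℂ)) : Prop where
  lie : IsLieSubC L
  one : E 0 1 ∈ L
  ell : E 0 X ∈ L
  p1 : E 1 1 ∈ L
  m1 : E (-1) 1 ∈ L

lemma HB.up {L} (h : HB L) {m : ℤ} {f : ℂ[X]} (hf : E m f ∈ L) (k : ℤ) (hk : k = m + 1) :
    E k (derivative f) ∈ L :=
  brk h.lie hf h.p1 k hk _ 1 one_ne_zero (by simp)

lemma HB.down {L} (h : HB L) {m : ℤ} {f : ℂ[X]} (hf : E m f ∈ L) (k : ℤ) (hk : k = m - 1) :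
    E k (derivative f) ∈ L :=
  brk h.lie hf h.m1 k (by omega) _ (-1) (by norm_num) (by simp)

lemma HB.up_iter {L} (h : HB L) {m : ℤ} {f : ℂ[X]} (hf : E m f ∈ L) (j : ℕ) :
    E (m + j) (derivative^[j] f) ∈ L := by
  induction j with
  | zero => simpa using hf
  | succ j ih =>
    rw [Function.iterate_succ_apply']
    exact h.up ih _ (by push_cast; ring)

lemma HB.down_iter {L} (h : HB L) {m : ℤ} {f : ℂ[X]} (hf : E m f ∈ L) (j : ℕ) :
    E (m - j) (derivative^[j] f) ∈ L := by
  induction j with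
  | zero => simpa using hf
  | succ j ih =>
    rw [Function.iterate_succ_apply']
    exact h.down ih _ (by push_cast; ring)

/-- weight decomposition -/
lemma HB.weights {L} (h : HB L) (s : Finset ℤ) : ∀ (f : ℤ → ℂ[X]),
    (∑ m ∈ s, E m (f m)) ∈ L → ∀ m ∈ s, E m (f m) ∈ L := by
  induction s using Finset.induction_on with
  | empty => intro f _ m hm; simp at hm
  | insert a s ha ih =>
    intro f hf
    have h1 := h.lie _ _ h.ell hf
    have h2 : pbC (E 0 X) (∑ m ∈ insert a s, E m (f m)) =
        ∑ m ∈ insert a s, E m (C (Complex.I * m) * f m) := by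
      funext p
      have t1 : pdThetaC (E 0 X) p = 0 := by
        rw [pdThetaC, (E_hasDerivAt_theta _ _ _).deriv]; simp
      have t2 : pdEllC (E 0 X) p = 1 := by
        rw [pdEllC, (E_hasDerivAt_ell _ _ _).deriv]; simp [E_apply]
      have t3 : pdThetaC (∑ m ∈ insert a s, E m (f m)) p =
          ∑ m ∈ insert a s, Complex.I * m * E m (f m) p := by
        have := HasDerivAt.fun_sum (u := insert a s)
          (fun m _ => E_hasDerivAt_theta m (f m) p)
        rw [pdThetaC, ← this.deriv]
        congr 1
        funext t
        rw [Finset.sum_apply]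
      simp only [pbC, t1, t2, t3, Finset.sum_apply, E_C_mul]
      simp
    rw [h2] at h1
    have h3 := sub_mem h1 (L.smul_mem (Complex.I * a) hf)
    rw [Finset.smul_sum, ← Finset.sum_sub_distrib, Finset.sum_insert ha] at h3
    have h4 : (∑ m ∈ s, E m (C (Complex.I * m - Complex.I * a) * f m)) ∈ L := by
      convert h3 using 1
      simp only [E_C_mul, sub_self, zero_add, sub_smul]
    have h5 := ih _ h4
    have h6 : ∀ m ∈ s, E m (f m) ∈ L := by
      intro m hm
      have hne : Complex.I * m - Complex.I * a ≠ 0 := by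
        rw [← mul_sub]
        refine mul_ne_zero Complex.I_ne_zero (sub_ne_zero.2 ?_)
        intro e
        have : m = a := by exact_mod_cast e
        exact ha (this ▸ hm)
      exact (E_C_mul_mem hne).1 (h5 m hm)
    intro m hm
    rcases Finset.mem_insert.1 hm with rfl | hm
    · rw [Finset.sum_insert ha] at hf
      have := sub_mem hf (sum_mem h6)
      simpa using this
    · exact h6 m hm

lemma HB_of {S : Submodule ℝ (ℝ × ℝ → ℝ)} (hS : IsLieSub S) (hB : Bsub ≤ S) (hP : S ≤ P) :
    HB (Cx S) := by
  obtain ⟨h1, h2, h3, h4⟩ := B_le.1 hB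
  have e1 : E 0 1 = cplx fone := by funext p; simp [E_apply, cplx, fone]
  have e2 : E 0 X = cplx fell := by funext p; simp [E_apply, cplx, fell]
  have e3 : E 1 1 = cplx fcos + Complex.I • cplx fsin := by
    have := E_XR 0 1
    simp only [pow_zero, one_mul, Int.cast_one] at this
    exact this
  have e4 : E (-1) 1 = cplx fcos - Complex.I • cplx fsin := by
    have := E_XR 0 (-1)
    rw [pow_zero] at this
    rw [this]; funext p; simp [fcos, fsin, cplx]; ring
  refine ⟨Cx_lie hS hP, ?_, ?_, ?_, ?_⟩
  · rw [e1]; exact cplx_mem_Cx.2 h1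
  · rw [e2]; exact cplx_mem_Cx.2 h2
  · rw [e3]; exact add_mem (cplx_mem_Cx.2 h4) (Submodule.smul_mem _ _ (cplx_mem_Cx.2 h3))
  · rw [e4]; exact sub_mem (cplx_mem_Cx.2 h4) (Submodule.smul_mem _ _ (cplx_mem_Cx.2 h3))

/-- the shifted variable -/
def xx (α : ℝ) : ℂ[X] := X + C (α : ℂ)

lemma dxx (α : ℝ) (r : ℕ) : derivative (xx α ^ r) = C (r : ℂ) * xx α ^ (r - 1) := by
  simp [xx, derivative_pow]

lemma brk_poly (α : ℝ) (m n : ℤ) (r s : ℕ) :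
    C (n : ℂ) * (derivative (xx α ^ r) * xx α ^ s) - C (m : ℂ) * (xx α ^ r * derivative (xx α ^ s))
      = C ((n : ℂ) * r - m * s) * xx α ^ (r + s - 1) := by
  rw [dxx, dxx]
  rcases r with _ | r <;> rcases s with _ | s
  · simp
  · simp; ring
  · simp; ring
  · have : r + 1 + (s + 1) - 1 = r + s + 1 := by omega
    rw [this]
    simp only [Nat.add_sub_cancel, C_sub, C_mul]
    ring

lemma brk_pow {L : Submodule ℂ (ℝ × ℝ → ℂ)} (hL : IsLieSubC L) {α : ℝ} {m n : ℤ} {r s : ℕ}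
    (hf : E m (xx α ^ r) ∈ L) (hg : E n (xx α ^ s) ∈ L) (k : ℤ) (t : ℕ) (hk : k = m + n)
    (ht : t = r + s - 1) (h : n * r - m * s ≠ 0) : E k (xx α ^ t) ∈ L := by
  refine brk hL hf hg k hk _ ((n : ℂ) * r - m * s) (by exact_mod_cast h) ?_
  rw [brk_poly, ht]

/-- explicit description of W -/
def Wup (α : ℝ) : Submodule ℂ (ℝ × ℝ → ℂ) :=
  Esp ({((0 : ℤ), (1 : ℂ[X]))} ∪ {a | ∃ (m : ℤ) (r : ℕ), Odd (r + m) ∧ a = (m, xx α ^ r)})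

lemma Wup_mem {α : ℝ} {m : ℤ} {r : ℕ} (h : Odd (r + m)) : E m (xx α ^ r) ∈ Wup α :=
  Submodule.subset_span ⟨_, Or.inr ⟨m, r, h, rfl⟩, rfl⟩

lemma Wup_lie (α : ℝ) : IsLieSubC (Wup α) := by
  refine Esp_lie ?_
  rintro ⟨m, f⟩ (hf | ⟨m, r, h1, hf⟩) ⟨n, g⟩ (hg | ⟨n, s, h2, hg⟩)
  · obtain ⟨rfl, rfl⟩ := Prod.mk.inj hf
    obtain ⟨rfl, rfl⟩ := Prod.mk.inj hg
    simp
  · obtain ⟨rfl, rfl⟩ := Prod.mk.inj hf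
    simp
  · obtain ⟨rfl, rfl⟩ := Prod.mk.inj hg
    simp
  · obtain ⟨rfl, rfl⟩ := Prod.mk.inj hf
    obtain ⟨rfl, rfl⟩ := Prod.mk.inj hg
    simp only
    rw [brk_poly, E_C_mul]
    rcases Nat.eq_zero_or_pos (r + s) with h0 | h0
    · have hr : r = 0 := by omega
      have hs : s = 0 := by omega
      simp [hr, hs]
    · refine Submodule.smul_mem _ _ (Wup_mem ?_)
      obtain ⟨a, ha⟩ := h1
      obtain ⟨b, hb⟩ := h2
      exact ⟨a + b, by omega⟩

lemma gen_eq (α : ℝ) (N : ℤ) : eC 2 (2 * N + 1) + (2 * α : ℂ) • eC 1 (2 * N + 1) =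
    E (2 * N + 1) (xx α ^ 2 - C ((α : ℂ) ^ 2)) := by
  rw [eC_eq, eC_eq, ← map_smul, ← map_add]
  congr 1
  rw [smul_eq_C_mul, xx]
  simp only [C_mul, C_pow, map_ofNat]
  ring

lemma one_eq : (fun _ => 1 : ℝ × ℝ → ℂ) = E 0 1 := by funext p; simp [E_apply]

lemma WGens_sub {α : ℝ} {L : Submodule ℂ (ℝ × ℝ → ℂ)} : WGens α ⊆ L ↔
    E 0 1 ∈ L ∧ E 1 1 ∈ L ∧ E (-1) 1 ∈ L ∧ E 0 X ∈ L ∧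
      ∀ N : ℤ, E (2 * N + 1) (xx α ^ 2 - C ((α : ℂ) ^ 2)) ∈ L := by
  rw [WGens, Set.union_subset_iff, one_eq, eC_eq, eC_eq, eC_eq]
  simp only [Set.insert_subset_iff, Set.singleton_subset_iff, SetLike.mem_coe, pow_zero, pow_one,
    and_assoc]
  refine and_congr_right fun _ => and_congr_right fun _ => and_congr_right fun _ =>
    and_congr_right fun _ => ?_
  constructor
  · intro h N
    rw [← gen_eq]
    exact h ⟨N, rfl⟩
  · rintro h _ ⟨N, rfl⟩
    rw [gen_eq]; exact h N

lemma HB_W (α : ℝ) : HB (W α) := by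
  have hl : IsLieSubC (W α) := by
    intro f g hf hg
    rw [W, Submodule.mem_sInf] at *
    intro S hS
    exact hS.2.2 _ _ (hf S hS) (hg S hS)
  have hg : WGens α ⊆ W α := by
    intro f hf
    rw [SetLike.mem_coe, W, Submodule.mem_sInf]
    intro S hS; exact hS.2.1 hf
  obtain ⟨h1, h2, h3, h4, _⟩ := WGens_sub.1 hg
  exact ⟨hl, h1, h4, h2, h3⟩

lemma W_gen (α : ℝ) (N : ℤ) : E (2 * N + 1) (xx α ^ 2 - C ((α : ℂ) ^ 2)) ∈ W α := by
  have hg : WGens α ⊆ W α := by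
    intro f hf
    rw [SetLike.mem_coe, W, Submodule.mem_sInf]
    intro S hS; exact hS.2.1 hf
  exact (WGens_sub.1 hg).2.2.2.2 N

lemma W_le {α : ℝ} {L : Submodule ℂ (ℝ × ℝ → ℂ)} (hL : L ≤ PC) (hB : HB L)
    (h : ∀ N : ℤ, E (2 * N + 1) (xx α ^ 2 - C ((α : ℂ) ^ 2)) ∈ L) : W α ≤ L :=
  sInf_le ⟨hL, WGens_sub.2 ⟨hB.one, hB.p1, hB.m1, hB.ell, h⟩, hB.lie⟩

lemma E_C (m : ℤ) (c : ℂ) : E m (C c) = c • E m 1 := by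
  rw [← E_C_mul, mul_one]

lemma W_le_Wup (α : ℝ) : W α ≤ Wup α := by
  have h1 : E 0 1 ∈ Wup α := Submodule.subset_span ⟨_, Or.inl rfl, rfl⟩
  have hodd : ∀ m : ℤ, Odd m → E m 1 ∈ Wup α := by
    intro m hm
    have := Wup_mem (α := α) (m := m) (r := 0) (by simpa using hm)
    simpa using this
  refine W_le (Esp_le_PC _) ⟨Wup_lie α, h1, ?_, hodd _ (by decide), hodd _ (by decide)⟩ ?_
  · have := Wup_mem (α := α) (m := 0) (r := 1) (by decide)
    rw [pow_one] at this
    have h2 := sub_mem this ((Wup α).smul_mem (α : ℂ) h1)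
    rw [← E_C, ← map_sub] at h2
    simpa [xx] using h2
  · intro N
    have h3 := Wup_mem (α := α) (m := 2 * N + 1) (r := 2) ⟨N + 1, by push_cast; ring⟩
    rw [map_sub, E_C]
    exact sub_mem h3 (Submodule.smul_mem _ _ (hodd _ ⟨N, rfl⟩))

lemma W_le_PC (α : ℝ) : W α ≤ PC := (W_le_Wup α).trans (Esp_le_PC _)

/-- from the quadratic generators to everything of odd type. -/
lemma odd_mem {L : Submodule ℂ (ℝ × ℝ → ℂ)} (h : HB L) {α : ℝ}
    (hg : ∀ N : ℤ, E (2 * N + 1) (xx α ^ 2 - C ((α : ℂ) ^ 2)) ∈ L) :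
    ∀ (r : ℕ) (m : ℤ), Odd (r + m) → E m (xx α ^ r) ∈ L := by
  have h1 : ∀ m : ℤ, Odd (1 + m) → E m (xx α ^ 1) ∈ L := by
    rintro m ⟨a, ha⟩
    have := h.up (hg (a - 1)) m (by omega)
    rw [derivative_sub, derivative_C, sub_zero, dxx, E_C_mul_mem (by norm_num)] at this
    exact this
  have h0 : ∀ m : ℤ, Odd m → E m (xx α ^ 0) ∈ L := by
    rintro m ⟨a, ha⟩
    have := h.up (h1 (m - 1) ⟨a, by omega⟩) m (by omega)
    rw [dxx, E_C_mul_mem (by norm_num)] at this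
    exact this
  have h2 : ∀ m : ℤ, Odd m → E m (xx α ^ 2) ∈ L := by
    intro m hm
    have h00 := h0 m hm
    obtain ⟨a, rfl⟩ := hm
    have := add_mem (hg a) (L.smul_mem ((α : ℂ) ^ 2) h00)
    rw [pow_zero, ← E_C, ← map_add, sub_add_cancel] at this
    exact this
  intro r
  induction r with
  | zero => intro m hm; exact h0 m (by simpa using hm)
  | succ r ih =>
    intro m hm
    rcases Nat.lt_or_ge r 2 with hr | hr
    · interval_cases r
      · exact h1 m (by simpa using hm)
      · exact h2 m (by obtain ⟨a, ha⟩ := hm; exact ⟨a - 1, by push_cast at ha; omega⟩)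
    · obtain ⟨b, hb⟩ := hm
      push_cast at hb
      by_cases hc : 2 * m - (r + 2) = 0
      · refine brk_pow h.lie (h2 (-1) (by decide)) (ih (m + 1) ⟨b, by omega⟩) m (r + 1) (by ring)
          (by omega) ?_
        push_cast; omega
      · refine brk_pow h.lie (h2 1 (by decide)) (ih (m - 1) ⟨b - 1, by omega⟩) m (r + 1) (by ring)
          (by omega) ?_
        push_cast; omega

lemma W_odd {α : ℝ} {r : ℕ} {m : ℤ} (h : Odd (r + m)) : E m (xx α ^ r) ∈ W α :=
  odd_mem (HB_W α) (W_gen α) r m h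

lemma V_eq (α : ℝ) : V α = Re' (W α) := rfl

lemma mem_V {α : ℝ} {f : ℝ × ℝ → ℝ} : f ∈ V α ↔ cplx f ∈ W α := Iff.rfl

lemma V_le_P (α : ℝ) : V α ≤ P := fun _ hf => cplx_mem_Cx.1 (PC_le_Cx_P (W_le_PC α hf))

lemma V_lie (α : ℝ) : IsLieSub (V α) := by
  intro f g hf hg
  rw [mem_V, cplx_pb (DR_P (V_le_P α hf)) (DR_P (V_le_P α hg))]
  exact (HB_W α).lie _ _ hf hg

lemma map_xx (α : ℝ) (r : ℕ) : (xx α ^ r).map (starRingEnd ℂ) = xx α ^ r := by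
  simp [xx]

lemma Cx_V_of {α : ℝ} {m : ℤ} {g : ℂ[X]} (hg : g.map (starRingEnd ℂ) = g)
    (h1 : E m g ∈ W α) (h2 : E (-m) g ∈ W α) : E m g ∈ Cx (V α) := by
  have hc := conj_E m g
  rw [hg] at hc
  rw [← hc] at h2
  refine ⟨?_, ?_⟩
  · rw [mem_V]
    convert (W α).smul_mem (1 / 2 : ℂ) (add_mem h1 h2) using 1
    funext p
    simp only [cplx, Pi.smul_apply, Pi.add_apply, smul_eq_mul]
    rw [Complex.add_conj]; push_cast; ring
  · rw [mem_V]
    convert (W α).smul_mem (-Complex.I / 2 : ℂ) (sub_mem h1 h2) using 1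
    funext p
    simp only [cplx, Pi.smul_apply, Pi.sub_apply, smul_eq_mul]
    rw [Complex.sub_conj]; push_cast; ring_nf; simp

lemma Cx_V_odd {α : ℝ} {r : ℕ} {m : ℤ} (h : Odd (r + m)) : E m (xx α ^ r) ∈ Cx (V α) := by
  refine Cx_V_of (map_xx α r) (W_odd h) (W_odd ?_)
  obtain ⟨a, ha⟩ := h
  exact ⟨a - m, by omega⟩

lemma B_le_V (α : ℝ) : Bsub ≤ V α := by
  have h := HB_W α
  have c0 := cplx_cos 0 1
  have s0 := cplx_sin 0 1
  simp only [pow_zero, Int.cast_one, one_mul] at c0 s0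
  refine B_le.2 ⟨?_, ?_, ?_, ?_⟩
  · rw [mem_V]
    have : cplx fone = E 0 1 := by funext p; simp [E_apply, cplx, fone]
    rw [this]; exact h.one
  · rw [mem_V]
    have : cplx fell = E 0 X := by funext p; simp [E_apply, cplx, fell]
    rw [this]; exact h.ell
  · rw [mem_V]
    show cplx (fun p => Real.sin p.1) ∈ _
    rw [s0]; exact Submodule.smul_mem _ _ (sub_mem h.p1 h.m1)
  · rw [mem_V]
    show cplx (fun p => Real.cos p.1) ∈ _
    rw [c0]; exact Submodule.smul_mem _ _ (add_mem h.p1 h.m1)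

lemma Wup_sym {α : ℝ} {f : ℝ × ℝ → ℂ} (hf : f ∈ Wup α) :
    ∃ c : ℂ, ∀ p : ℝ × ℝ, f (p.1 + Real.pi, -p.2 - 2 * α) + f p = c := by
  refine Submodule.span_induction (p := fun f _ => ∃ c : ℂ, ∀ p : ℝ × ℝ,
    f (p.1 + Real.pi, -p.2 - 2 * α) + f p = c) ?_ ?_ ?_ ?_ hf
  · rintro _ ⟨a, ha | ⟨m, r, h, ha⟩, rfl⟩
    · obtain rfl : a = _ := ha
      exact ⟨2, fun p => by simp [E_apply]; norm_num⟩
    · subst ha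
      refine ⟨0, fun p => ?_⟩
      simp only [E_apply, xx, eval_pow, eval_add, eval_X, eval_C]
      have e1 : Complex.exp (Complex.I * (m : ℂ) * ((p.1 + Real.pi : ℝ) : ℂ)) =
          (-1) ^ m * Complex.exp (Complex.I * (m : ℂ) * (p.1 : ℂ)) := by
        rw [show Complex.I * (m : ℂ) * ((p.1 + Real.pi : ℝ) : ℂ) =
          (m : ℂ) * (Real.pi * Complex.I) + Complex.I * (m : ℂ) * (p.1 : ℂ) by push_cast; ring,
          Complex.exp_add, Complex.exp_int_mul, Complex.exp_pi_mul_I]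
      have e2 : (((-p.2 - 2 * α : ℝ) : ℂ) + (α : ℂ)) = -((p.2 : ℂ) + α) := by push_cast; ring
      rw [e1, e2]
      rcases Nat.even_or_odd r with hr | hr
      · have hm : Odd m := by
          obtain ⟨a, ha⟩ := hr; obtain ⟨b, hb⟩ := h; exact ⟨b - a, by omega⟩
        rw [hr.neg_pow, hm.neg_one_zpow]; ring
      · have hm : Even m := by
          obtain ⟨a, ha⟩ := hr; obtain ⟨b, hb⟩ := h; exact ⟨b - a, by omega⟩
        rw [hr.neg_pow, hm.neg_one_zpow]; ring
  · exact ⟨0, fun p => by simp⟩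
  · rintro f g _ _ ⟨c, hc⟩ ⟨d, hd⟩
    refine ⟨c + d, fun p => ?_⟩
    simp only [Pi.add_apply]
    linear_combination hc p + hd p
  · rintro k f _ ⟨c, hc⟩
    refine ⟨k * c, fun p => ?_⟩
    simp only [Pi.smul_apply, smul_eq_mul]
    linear_combination k * hc p

/-- cos 2θ -/
def c2 : ℝ × ℝ → ℝ := fun p => p.2 ^ 0 * Real.cos ((2 : ℕ) * p.1)

lemma c2_P1 : c2 ∈ P1 := Submodule.subset_span ⟨0, 2, by norm_num, Or.inr rfl⟩

lemma c2_not_V (α : ℝ) : c2 ∉ V α := by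
  intro h
  obtain ⟨c, hc⟩ := Wup_sym (W_le_Wup α h)
  have h1 := hc (0, 0)
  have h2 := hc (Real.pi / 2, 0)
  rw [← h1] at h2
  simp only [cplx, c2] at h2
  have e1 : Real.cos ((2 : ℕ) * (Real.pi / 2 + Real.pi)) = -1 := by
    rw [show ((2 : ℕ) : ℝ) * (Real.pi / 2 + Real.pi) = Real.pi + 2 * Real.pi by push_cast; ring]
    simp
  have e2 : Real.cos ((2 : ℕ) * (Real.pi / 2)) = -1 := by
    rw [show ((2 : ℕ) : ℝ) * (Real.pi / 2) = Real.pi by push_cast; ring]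
    simp
  have e3 : Real.cos ((2 : ℕ) * (0 + Real.pi)) = 1 := by simp
  have e4 : Real.cos ((2 : ℕ) * 0) = 1 := by simp
  rw [e1, e2, e3, e4] at h2
  norm_num at h2

lemma even_exists {α : ℝ} {L : Submodule ℂ (ℝ × ℝ → ℂ)} (h : HB L)
    (ho : ∀ (r : ℕ) (m : ℤ), Odd (r + m) → E m (xx α ^ r) ∈ L) :
    ∀ (d : ℕ) (m : ℤ) (f : ℂ[X]), f.natDegree = d → E m f ∈ L → E m f ∉ W α →
      ∃ k : ℤ, Even k ∧ k ≠ 0 ∧ E k 1 ∈ L := by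
  intro d
  induction d using Nat.strong_induction_on with
  | _ d ih =>
    intro m f hd hf hn
    have hf0 : f ≠ 0 := by rintro rfl; simp at hn
    rcases Int.even_or_odd (d + m) with he | hod
    · have hc : derivative^[d] f = C ((d.factorial : ℂ) * f.leadingCoeff) := by
        have hnd : (derivative^[d] f).natDegree = 0 := by
          have := natDegree_iterate_derivative f d
          omega
        rw [eq_C_of_natDegree_eq_zero hnd, coeff_iterate_derivative, zero_add,
          Nat.descFactorial_self, nsmul_eq_mul, leadingCoeff, hd]
      have hne : (d.factorial : ℂ) * f.leadingCoeff ≠ 0 :=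
        mul_ne_zero (by exact_mod_cast d.factorial_ne_zero) (leadingCoeff_ne_zero.2 hf0)
      have hu := h.up_iter hf d
      have hl := h.down_iter hf d
      rw [hc, E_C, Submodule.smul_mem_iff _ hne] at hu hl
      by_cases hz : m + d = 0
      · by_cases hz2 : m - d = 0
        · have d0 : d = 0 := by omega
          have m0 : m = 0 := by omega
          exfalso; apply hn
          rw [eq_C_of_natDegree_eq_zero (hd.trans d0), E_C, m0]
          exact Submodule.smul_mem _ _ (HB_W α).one
        · refine ⟨_, ?_, hz2, hl⟩
          obtain ⟨a, ha⟩ := he; exact ⟨a - d, by omega⟩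
      · exact ⟨_, by rwa [add_comm], hz, hu⟩
    · set g := C f.leadingCoeff * xx α ^ d with hg
      have gW : E m g ∈ W α := by rw [hg, E_C_mul]; exact Submodule.smul_mem _ _ (W_odd hod)
      have gL : E m g ∈ L := by rw [hg, E_C_mul]; exact Submodule.smul_mem _ _ (ho _ _ hod)
      have hmon : (xx α ^ d).Monic := (monic_X_add_C _).pow d
      have hlc : f.leadingCoeff ≠ 0 := leadingCoeff_ne_zero.2 hf0
      have hnd : (xx α ^ d).natDegree = d := by
        rw [xx, natDegree_pow, natDegree_X_add_C, mul_one]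
      have hgd : g.natDegree = d := by
        rw [hg, natDegree_C_mul hlc, hnd]
      have hglc : g.leadingCoeff = f.leadingCoeff := by
        rw [hg, leadingCoeff_mul, hmon.leadingCoeff, leadingCoeff_C, mul_one]
      have hg0 : g ≠ 0 := by
        intro e; rw [e, leadingCoeff_zero] at hglc; exact hlc hglc.symm
      have hlt : (f - g).degree < f.degree := degree_sub_lt
        (by rw [degree_eq_natDegree hf0, degree_eq_natDegree hg0, hd, hgd]) hf0 hglc.symm
      have h1 : E m (f - g) ∈ L := by rw [map_sub]; exact sub_mem hf gL
      have h2 : E m (f - g) ∉ W α := by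
        intro hw
        apply hn
        have := add_mem hw gW
        rwa [map_sub, sub_add_cancel] at this
      have h3 : f - g ≠ 0 := by intro e; rw [e] at h2; simp at h2
      refine ih _ ?_ m (f - g) rfl h1 h2
      rw [← hd]; exact natDegree_lt_natDegree h3 hlt

lemma all_mem {α : ℝ} {L : Submodule ℂ (ℝ × ℝ → ℂ)} (h : HB L)
    (ho : ∀ (r : ℕ) (m : ℤ), Odd (r + m) → E m (xx α ^ r) ∈ L) {k : ℤ} (hk : Even k) (hk0 : k ≠ 0)
    (hkL : E k 1 ∈ L) (m : ℤ) (f : ℂ[X]) : E m f ∈ L := by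
  have hx : ∀ r : ℕ, E m (xx α ^ r) ∈ L := by
    intro r
    rcases Int.even_or_odd (r + m) with he | hod
    · have h1 := ho (r + 1) (m - k) (by
        obtain ⟨a, ha⟩ := he; obtain ⟨b, hb⟩ := hk; exact ⟨a - b, by push_cast; omega⟩)
      have h2 : E k (xx α ^ 0) ∈ L := by rwa [pow_zero]
      refine brk_pow h.lie h1 h2 m r (by ring) (by omega) ?_
      push_cast
      have : (r : ℤ) + 1 ≠ 0 := by omega
      simpa using ⟨hk0, this⟩
    · exact ho r m hod
  have : f = (f.comp (X - C (α : ℂ))).comp (xx α) := by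
    rw [comp_assoc, xx]; simp
  rw [this]
  generalize f.comp (X - C (α : ℂ)) = g
  induction g using Polynomial.induction_on' with
  | add p q hp hq => rw [add_comp, map_add]; exact add_mem hp hq
  | monomial n a => rw [monomial_comp, E_C_mul]; exact Submodule.smul_mem _ _ (hx n)

lemma V_max {α : ℝ} {T : Submodule ℝ (ℝ × ℝ → ℝ)} (hT : IsLieSub T) (hP : T ≤ P) (hV : V α < T) :
    T = P := by
  refine le_antisymm hP ?_
  have hB := HB_of hT ((B_le_V α).trans hV.le) hP
  have ho : ∀ (r : ℕ) (m : ℤ), Odd (r + m) → E m (xx α ^ r) ∈ Cx T :=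
    fun r m h => Cx_mono hV.le (Cx_V_odd h)
  obtain ⟨h, hhT, hhV⟩ := SetLike.exists_of_lt hV
  obtain ⟨s, f, hf⟩ := PC_sum (cplx_mem_PC (hP hhT))
  have hw := hB.weights s f (hf ▸ cplx_mem_Cx.2 hhT)
  have : ∃ m ∈ s, E m (f m) ∉ W α := by
    by_contra hcon
    push Not at hcon
    apply hhV
    rw [mem_V, hf]
    exact sum_mem hcon
  obtain ⟨m, hm, hmW⟩ := this
  obtain ⟨k, hk, hk0, hkL⟩ := even_exists hB ho _ m (f m) rfl (hw m hm) hmW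
  intro u hu
  exact cplx_mem_Cx.1 (P_le_Re (L := Cx T) (fun m r => all_mem hB ho hk hk0 hkL m _) hu)

/-- From `y² e_{±1}` to `W α`. -/
lemma from_sq {L : Submodule ℂ (ℝ × ℝ → ℂ)} (hB : HB L) {α : ℝ}
    (h1 : E 1 (xx α ^ 2) ∈ L) (h2 : E (-1) (xx α ^ 2) ∈ L) (N : ℤ) :
    E (2 * N + 1) (xx α ^ 2 - C ((α : ℂ) ^ 2)) ∈ L := by
  have u : E 2 (xx α ^ 1) ∈ L := by
    have := hB.up h1 2 (by norm_num)
    rwa [dxx, E_C_mul_mem (by norm_num)] at this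
  have d : E (-2) (xx α ^ 1) ∈ L := by
    have := hB.down h2 (-2) (by norm_num)
    rwa [dxx, E_C_mul_mem (by norm_num)] at this
  have sq : ∀ N : ℤ, E (2 * N + 1) (xx α ^ 2) ∈ L := by
    intro N
    induction N using Int.induction_on with
    | zero => simpa using h1
    | succ i ih => 
      refine brk_pow hB.lie ih u _ 2 (by ring) (by norm_num) ?_
      push_cast; omega
    | pred i ih =>
      refine brk_pow hB.lie ih d _ 2 (by ring) (by norm_num) ?_
      push_cast; omega
  have e : E (2 * N + 1) 1 ∈ L := by
    have a := hB.up (hB.down (sq N) (2 * N) (by ring)) (2 * N + 1) (by ring)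
    rw [dxx, derivative_C_mul, dxx, E_C_mul_mem (by norm_num), E_C_mul_mem (by norm_num)] at a
    simpa using a
  rw [map_sub, E_C]
  exact sub_mem (sq N) (Submodule.smul_mem _ _ e)

/-- a real quadratic in both weights ±1 -/
lemma sq_exists {S : Submodule ℝ (ℝ × ℝ → ℝ)} (hS : IsLieSub S) (hBS : Bsub ≤ S) (hP : S ≤ P)
    {m : ℤ} {a b : ℂ} (hf : E m (X ^ 2 + C a * X + C b) ∈ Cx S) :
    ∃ α : ℝ, E 1 (xx α ^ 2) ∈ Cx S ∧ E (-1) (xx α ^ 2) ∈ Cx S := by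
  have hB := HB_of hS hBS hP
  by_cases hm : m = 0
  · subst hm
    have hq : E 0 (X ^ 2) ∈ Cx S := by
      have h1 := (Cx S).smul_mem a hB.ell
      have h2 := (Cx S).smul_mem b hB.one
      have := sub_mem (sub_mem hf h1) h2
      rw [← E_C_mul, ← E_C_mul, ← map_sub, ← map_sub] at this
      convert this using 2
      ring
    refine ⟨0, ?_, ?_⟩
    · have := hB.up hq 1 (by norm_num)
      refine brk hB.lie hq this 1 (by norm_num) _ 4 (by norm_num) ?_
      simp [xx]; ring_nf; rw [map_ofNat]
    · have := hB.down hq (-1) (by norm_num)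
      refine brk hB.lie hq this (-1) (by norm_num) _ (-4) (by norm_num) ?_
      simp [xx]; ring_nf; rw [map_ofNat]
  · have hc := Cx_conj hf
    rw [conj_E] at hc
    simp only [Polynomial.map_add, Polynomial.map_mul, Polynomial.map_pow, map_X, map_C] at hc
    set a' := (starRingEnd ℂ) a with ha'
    set b' := (starRingEnd ℂ) b with hb'
    have hb := brk hB.lie hf hc 0 (by ring)
      (derivative ((X ^ 2 + C a * X + C b) * (X ^ 2 + C a' * X + C b'))) (-m)
      (by simpa using hm) (by
        rw [derivative_mul]
        simp only [Int.cast_neg, C_neg]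
        ring)
    set α : ℝ := a.re / 2 with hα
    have haa : C a + C a' = (4 : ℂ[X]) * C (α : ℂ) := by
      rw [← C_add, ha', Complex.add_conj, hα]
      have : ((2 * a.re : ℝ) : ℂ) = 4 * ((a.re / 2 : ℝ) : ℂ) := by push_cast; ring
      rw [this, C_mul, map_ofNat]
    have key : derivative (derivative ((X ^ 2 + C a * X + C b) * (X ^ 2 + C a' * X + C b'))) =
        C 12 * xx α ^ 2 + C (2 * b + 2 * b' + 2 * (a * a') - 12 * (α : ℂ) ^ 2) := by
      simp only [derivative_mul, derivative_add, derivative_X_pow, derivative_C, derivative_X,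
        xx, C_sub, C_add, C_mul, C_pow]
      simp only [map_ofNat, Nat.cast_ofNat]
      simp
      linear_combination (6 * X) * haa
    refine ⟨α, ?_, ?_⟩
    · have h1 := hB.up hb 1 (by norm_num)
      rw [key, map_add, E_C, E_C_mul] at h1
      have h2 := sub_mem h1 ((Cx S).smul_mem
        (2 * b + 2 * b' + 2 * (a * a') - 12 * (α : ℂ) ^ 2) hB.p1)
      rw [add_sub_cancel_right] at h2
      exact (Submodule.smul_mem_iff _ (by norm_num)).1 h2
    · have h1 := hB.down hb (-1) (by norm_num)
      rw [key, map_add, E_C, E_C_mul] at h1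
      have h2 := sub_mem h1 ((Cx S).smul_mem
        (2 * b + 2 * b' + 2 * (a * a') - 12 * (α : ℂ) ^ 2) hB.m1)
      rw [add_sub_cancel_right] at h2
      exact (Submodule.smul_mem_iff _ (by norm_num)).1 h2

lemma V_le_of {S : Submodule ℝ (ℝ × ℝ → ℝ)} (hS : IsLieSub S) (hBS : Bsub ≤ S) (hP : S ≤ P)
    (hn : ¬ S ≤ P1) : ∃ α : ℝ, V α ≤ S := by
  have hB := HB_of hS hBS hP
  obtain ⟨h, hhS, hh1⟩ := SetLike.not_le_iff_exists.1 hn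
  obtain ⟨s, f, hf⟩ := PC_sum (cplx_mem_PC (hP hhS))
  have hw := hB.weights s f (hf ▸ cplx_mem_Cx.2 hhS)
  have : ∃ m ∈ s, ¬ (f m).natDegree ≤ 1 := by
    by_contra hcon
    push Not at hcon
    apply hh1
    rw [← cplx_mem_Cx, hf]
    exact sum_mem fun m hm => P1C_le (E_mem_P1C (hcon m hm))
  obtain ⟨m, hm, hd⟩ := this
  set g := f m with hg
  have hit := hB.up_iter (hw m hm) (g.natDegree - 2)
  rw [← hg] at hit
  set q := derivative^[g.natDegree - 2] g with hq
  have hqd : q.natDegree ≤ 2 := by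
    have := natDegree_iterate_derivative g (g.natDegree - 2)
    rw [← hq] at this; omega
  have hqe := eq_quadratic_of_degree_le_two (p := q) (degree_le_of_natDegree_le hqd)
  have hq2 : q.coeff 2 ≠ 0 := by
    have e : 2 + (g.natDegree - 2) = g.natDegree := by omega
    rw [hq, coeff_iterate_derivative, e, nsmul_eq_mul]
    refine mul_ne_zero ?_ (leadingCoeff_ne_zero.2 ?_)
    · have := Nat.descFactorial_eq_zero_iff_lt (n := g.natDegree) (k := g.natDegree - 2)
      have h3 : g.natDegree.descFactorial (g.natDegree - 2) ≠ 0 := by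
        rw [Ne, this]; omega
      exact_mod_cast h3
    · intro e; rw [e] at hd; simp at hd
  have hqm : q = C (q.coeff 2) * (X ^ 2 + C (q.coeff 1 / q.coeff 2) * X +
      C (q.coeff 0 / q.coeff 2)) := by
    conv_lhs => rw [hqe]
    rw [mul_add, mul_add, ← mul_assoc, ← C_mul, ← C_mul, mul_div_cancel₀ _ hq2,
      mul_div_cancel₀ _ hq2]
  rw [hqm, E_C_mul_mem hq2] at hit
  obtain ⟨α, h1, h2⟩ := sq_exists hS hBS hP hit
  refine ⟨α, fun u hu => ?_⟩
  exact cplx_mem_Cx.1 (W_le (Cx_le_PC hP) hB (from_sq hB h1 h2) hu)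

/-- `P¹` and the `V_α` (`α ∈ ℝ`) are exactly the proper maximal Lie subalgebras of `P`
containing the basic set `B`. -/
theorem stmt10 :
    (IsLieSub P1 ∧ Bsub ≤ P1 ∧ P1 ≤ P ∧ P1 ≠ P ∧
      ∀ T : Submodule ℝ (ℝ × ℝ → ℝ), IsLieSub T → T ≤ P → P1 < T → T = P) ∧
    (∀ α : ℝ, IsLieSub (V α) ∧ Bsub ≤ V α ∧ V α ≤ P ∧ V α ≠ P ∧
      ∀ T : Submodule ℝ (ℝ × ℝ → ℝ), IsLieSub T → T ≤ P → V α < T → T = P) ∧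
    (∀ S : Submodule ℝ (ℝ × ℝ → ℝ), IsLieSub S → Bsub ≤ S → S ≤ P → S ≠ P →
      (∀ T : Submodule ℝ (ℝ × ℝ → ℝ), IsLieSub T → T ≤ P → S < T → T = P) →
      S = P1 ∨ ∃ α : ℝ, S = V α) := by
  have hB1 : Bsub ≤ P1 := B_le.2 ⟨fone_mem_P1, fell_mem_P1, fsin_mem_P1, fcos_mem_P1⟩
  refine ⟨⟨P1_lie, hB1, P1_le_P, P1_ne_P, ?_⟩, ?_, ?_⟩
  · intro T hT hP h1
    obtain ⟨α, hα⟩ := V_le_of hT (hB1.trans h1.le) hP (not_le_of_gt h1)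
    rcases hα.lt_or_eq with h | h
    · exact V_max hT hP h
    · exact absurd (h ▸ h1.le c2_P1) (c2_not_V α)
  · intro α
    refine ⟨V_lie α, B_le_V α, V_le_P α, ?_, fun T hT hP hV => V_max hT hP hV⟩
    intro h
    exact c2_not_V α (h ▸ P1_le_P c2_P1)
  · intro S hS hB hP hne hmax
    by_cases h1 : S ≤ P1
    · left
      rcases h1.lt_or_eq with h | h
      · exact absurd (hmax P1 P1_lie P1_le_P h) P1_ne_P
      · exact h
    · right
      obtain ⟨α, hα⟩ := V_le_of hS hB hP h1
      refine ⟨α, ?_⟩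
      rcases hα.lt_or_eq with h | h
      · exact absurd (V_max hS hP h) hne
      · exact h.symm
end
end

section
/- Let α, ν ∈ ℝ and let Q be an admissible quantization of V_α of type (i)′ with parameter ν. Then ℓ³ + 3αℓ² belongs to V_α, and there exist real numbers b′ and c′ such that Q(ℓ³ + 3αℓ²) = Q(ℓ)³ + 3α·Q(ℓ)² + b′·Q(ℓ) + c′·I as linear operators on D. -/
noncomputable section
lemma mem_W_of_mem_WGens {α : ℝ} {f : ℝ × ℝ → ℂ} (hf : f ∈ WGens α) : f ∈ W α := by
  rw [W, Submodule.mem_sInf]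
  exact fun S hS => hS.2.1 hf

lemma fone_mem_V (α : ℝ) : fone ∈ V α := by
  show cplx fone ∈ W α
  have h : cplx fone = fun _ => (1 : ℂ) := by funext p; simp [cplx, fone]
  rw [h]
  exact mem_W_of_mem_WGens (Or.inl (by simp))

lemma fell_mem_V (α : ℝ) : fell ∈ V α := by
  show cplx fell ∈ W α
  have h : cplx fell = eC 1 0 := by
    funext p; simp [cplx, fell, eC]
  rw [h]
  exact mem_W_of_mem_WGens (Or.inl (by simp [WGens]))

lemma fsin_mem_V (α : ℝ) : fsin ∈ V α := by
  show cplx fsin ∈ W α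
  have h : cplx fsin = (Complex.I / 2) • eC 0 (-1) - (Complex.I / 2) • eC 0 1 := by
    funext p
    have h1 : Complex.I * (((1 : ℤ) : ℂ)) * (p.1 : ℂ) = (p.1 : ℂ) * Complex.I := by
      push_cast; ring
    have h2 : Complex.I * (((-1 : ℤ) : ℂ)) * (p.1 : ℂ) = -(p.1 : ℂ) * Complex.I := by
      push_cast; ring
    simp only [cplx, fsin, eC, Pi.sub_apply, Pi.smul_apply, smul_eq_mul, pow_zero, one_mul,
      h1, h2, Complex.ofReal_sin]
    rw [Complex.sin]
    ring
  rw [h]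
  exact sub_mem
    (Submodule.smul_mem _ _ (mem_W_of_mem_WGens (Or.inl (by simp [WGens]))))
    (Submodule.smul_mem _ _ (mem_W_of_mem_WGens (Or.inl (by simp [WGens]))))

lemma fcos_mem_V (α : ℝ) : fcos ∈ V α := by
  show cplx fcos ∈ W α
  have h : cplx fcos = ((1 : ℂ) / 2) • eC 0 1 + ((1 : ℂ) / 2) • eC 0 (-1) := by
    funext p
    have h1 : Complex.I * (((1 : ℤ) : ℂ)) * (p.1 : ℂ) = (p.1 : ℂ) * Complex.I := by
      push_cast; ring
    have h2 : Complex.I * (((-1 : ℤ) : ℂ)) * (p.1 : ℂ) = -(p.1 : ℂ) * Complex.I := by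
      push_cast; ring
    simp only [cplx, fcos, eC, Pi.add_apply, Pi.smul_apply, smul_eq_mul, pow_zero, one_mul,
      h1, h2, Complex.ofReal_cos]
    rw [Complex.cos]
    ring
  rw [h]
  exact add_mem
    (Submodule.smul_mem _ _ (mem_W_of_mem_WGens (Or.inl (by simp [WGens]))))
    (Submodule.smul_mem _ _ (mem_W_of_mem_WGens (Or.inl (by simp [WGens]))))
end
noncomputable section
/-- `ℓ³ + 3αℓ²`. -/
def fcube (α : ℝ) : ℝ × ℝ → ℝ := fun p => p.2 ^ 3 + 3 * α * p.2 ^ 2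

lemma aux_W_lie {α : ℝ} {f g : ℝ × ℝ → ℂ} (hf : f ∈ W α) (hg : g ∈ W α) : pbC f g ∈ W α := by
  rw [W, Submodule.mem_sInf] at *
  exact fun S hS => hS.2.2 f g (hf S hS) (hg S hS)

lemma aux_deriv_ofReal (f : ℝ → ℝ) (x : ℝ) (h : DifferentiableAt ℝ f x) :
    deriv (fun t => (f t : ℂ)) x = ((deriv f x : ℝ) : ℂ) :=
  (h.hasDerivAt.ofReal_comp).deriv

lemma aux_V_lie {α : ℝ} {f g : ℝ × ℝ → ℝ} (hf : f ∈ V α) (hg : g ∈ V α)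
    (df : Differentiable ℝ f) (dg : Differentiable ℝ g) : pb f g ∈ V α := by
  change cplx _ ∈ W α
  have : cplx (pb f g) = pbC (cplx f) (cplx g) := by
    funext p
    simp only [cplx, pb, pbC, pdEll, pdTheta, pdEllC, pdThetaC]
    rw [aux_deriv_ofReal, aux_deriv_ofReal, aux_deriv_ofReal, aux_deriv_ofReal]
    · push_cast; rfl
    all_goals fun_prop
  rw [this]
  exact aux_W_lie hf hg

lemma aux_eC_theta (c : ℂ) (k : ℂ) (x : ℝ) :
    HasDerivAt (fun t : ℝ => c * Complex.exp (Complex.I * k * (t : ℂ)))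
      (c * (Complex.exp (Complex.I * k * (x : ℂ)) * (Complex.I * k))) x := by
  have h1 : HasDerivAt (fun t : ℝ => Complex.I * k * (t : ℂ)) (Complex.I * k) x := by
    simpa using (Complex.ofRealCLM.hasDerivAt (x := x)).const_mul (Complex.I * k)
  exact (h1.cexp).const_mul c

lemma aux_cube_mem (α : ℝ) : fcube α ∈ V α := by
  change cplx _ ∈ W α
  have h1 : eC 2 1 + (2 * α : ℂ) • eC 1 1 ∈ W α :=
    mem_W_of_mem_WGens (Or.inr ⟨0, by simp⟩)
  have h2 : eC 2 (-1) + (2 * α : ℂ) • eC 1 (-1) ∈ W α :=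
    mem_W_of_mem_WGens (Or.inr ⟨-1, by simp⟩)
  have h3 : eC 1 0 ∈ W α := mem_W_of_mem_WGens (Or.inl (by simp))
  have hth : ∀ (m : ℤ) (p : ℝ × ℝ), pdThetaC (eC 2 m + (2 * α : ℂ) • eC 1 m) p =
      ((p.2 : ℂ)^2 + 2 * α * p.2) * (Complex.exp (Complex.I * m * (p.1 : ℂ)) * (Complex.I * m)) := by
    intro m p
    rw [← (aux_eC_theta ((p.2 : ℂ)^2 + 2 * α * p.2) m p.1).deriv]
    unfold pdThetaC
    congr 1
    funext t
    simp [eC]; ring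
  have hel : ∀ (m : ℤ) (p : ℝ × ℝ), pdEllC (eC 2 m + (2 * α : ℂ) • eC 1 m) p =
      (2 * (p.2 : ℂ) + 2 * α) * Complex.exp (Complex.I * m * (p.1 : ℂ)) := by
    intro m p
    have h0 : HasDerivAt (fun l : ℝ => (l : ℂ)) 1 p.2 := by
      exact (hasDerivAt_id p.2).ofReal_comp
    have h := (((h0.pow 2).add (h0.const_mul (2 * α : ℂ))).mul_const
      (Complex.exp (Complex.I * m * (p.1 : ℂ)))).deriv
    unfold pdEllC
    convert h using 1
    · congr 1
      funext t
      simp [eC]; ring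
    · simp
  have : cplx (fcube α) = (Complex.I / 4) • pbC (eC 2 1 + (2 * α : ℂ) • eC 1 1)
      (eC 2 (-1) + (2 * α : ℂ) • eC 1 (-1)) - (2 * α^2 : ℂ) • eC 1 0 := by
    funext p
    simp only [Pi.sub_apply, Pi.smul_apply, smul_eq_mul, pbC, hth, hel]
    have he : Complex.exp (Complex.I * ((-1 : ℤ) : ℂ) * (p.1 : ℂ)) =
        (Complex.exp (Complex.I * ((1 : ℤ) : ℂ) * (p.1 : ℂ)))⁻¹ := by
      rw [← Complex.exp_neg]; congr 1; push_cast; ring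
    rw [he]
    have hne := Complex.exp_ne_zero (Complex.I * ((1 : ℤ) : ℂ) * (p.1 : ℂ))
    simp [cplx, fcube, eC]
    have hz := Complex.exp_ne_zero (Complex.I * (p.1 : ℂ))
    generalize Complex.exp (Complex.I * (p.1 : ℂ)) = z at *
    field_simp
    ring_nf
    simp
    try ring_nf
  rw [this]
  exact sub_mem (Submodule.smul_mem _ _ (aux_W_lie h1 h2)) (Submodule.smul_mem _ _ h3)

/-- exponentials -/
def auxE (k : ℤ) : Dom :=
  ⟨fun t => Complex.exp (Complex.I * (k : ℂ) * (t : ℂ)), by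
    refine ⟨?_, ?_⟩
    · have : ContDiff ℝ (⊤ : ℕ∞) (fun t : ℝ => (t : ℂ)) := Complex.ofRealCLM.contDiff
      exact (contDiff_const.mul this).cexp
    · intro t
      have : Complex.I * (k : ℂ) * ((t + 2 * Real.pi : ℝ) : ℂ) =
        Complex.I * (k : ℂ) * (t : ℂ) + k * (2 * Real.pi * Complex.I) := by push_cast; ring
      simp only [this]
      rw [Complex.exp_add, Complex.exp_int_mul_two_pi_mul_I, mul_one]⟩

lemma auxE_apply (k : ℤ) (t : ℝ) :
    (auxE k : ℝ → ℂ) t = Complex.exp (Complex.I * (k : ℂ) * (t : ℂ)) := rfl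

lemma auxE_deriv (k : ℤ) (t : ℝ) :
    deriv (auxE k : ℝ → ℂ) t = Complex.I * k * (auxE k : ℝ → ℂ) t := by
  have := (aux_eC_theta 1 k t).deriv
  simp only [one_mul] at this
  rw [auxE_apply, mul_comm, ← this]; rfl

lemma aux_cont (φ : Dom) : Continuous (φ : ℝ → ℂ) := φ.2.1.continuous

lemma aux_diff (φ : Dom) : Differentiable ℝ (φ : ℝ → ℂ) :=
  φ.2.1.differentiable (by simp)

lemma aux_eig (φ : Dom) (k : ℤ)
    (h : ∀ t, deriv (φ : ℝ → ℂ) t = Complex.I * k * (φ : ℝ → ℂ) t) :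
    ∃ c : ℂ, φ = c • auxE k := by
  refine ⟨(φ : ℝ → ℂ) 0, ?_⟩
  have hd : ∀ t : ℝ, HasDerivAt (fun t => (φ : ℝ → ℂ) t * (auxE (-k) : ℝ → ℂ) t) 0 t := by
    intro t
    have := ((aux_diff φ t).hasDerivAt).mul ((aux_diff (auxE (-k)) t).hasDerivAt)
    rw [h, auxE_deriv] at this
    exact this.congr_deriv (by push_cast; ring)
  have hc := is_const_of_deriv_eq_zero (fun t => (hd t).differentiableAt) (fun t => (hd t).deriv)
  ext t
  have h1 := hc t 0
  simp only [auxE_apply] at h1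
  have he : Complex.exp (Complex.I * ((-k : ℤ) : ℂ) * (t : ℂ)) =
        (Complex.exp (Complex.I * (k : ℂ) * (t : ℂ)))⁻¹ := by
      rw [← Complex.exp_neg]; congr 1; push_cast; ring
  rw [he] at h1
  have hne := Complex.exp_ne_zero (Complex.I * (k : ℂ) * (t : ℂ))
  simp at h1
  change _ = (φ : ℝ → ℂ) 0 * (auxE k : ℝ → ℂ) t
  rw [auxE_apply, ← h1]
  field_simp

lemma aux_zero (φ : Dom) (h : ∀ k : ℤ, ip (auxE k : ℝ → ℂ) (φ : ℝ → ℂ) = 0) : φ = 0 := by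
  haveI : Fact (0 < 2 * Real.pi) := ⟨Real.two_pi_pos⟩
  have hper : Function.Periodic (φ : ℝ → ℂ) (2 * Real.pi) := φ.2.2
  let F : C(AddCircle (2 * Real.pi), ℂ) := ⟨hper.lift, by
    exact continuous_coinduced_dom.mpr (aux_cont φ)⟩
  have hF : ∀ t : ℝ, F (t : AddCircle (2 * Real.pi)) = (φ : ℝ → ℂ) t := fun t => rfl
  have hco : fourierCoeff F = 0 := by
    funext k
    rw [fourierCoeff_eq_intervalIntegral _ _ 0]
    have : ∫ x in (0:ℝ)..(0 + 2 * Real.pi), fourier (-k) (x : AddCircle (2 * Real.pi)) •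
        F (x : AddCircle (2 * Real.pi)) = ip (auxE k : ℝ → ℂ) (φ : ℝ → ℂ) := by
      rw [zero_add]
      unfold ip
      congr 1
      funext x
      rw [hF, fourier_coe_apply, auxE_apply, ← Complex.exp_conj, smul_eq_mul]
      congr 2
      have hpi : (Real.pi : ℂ) ≠ 0 := by exact_mod_cast Real.pi_ne_zero
      simp
      field_simp
    rw [this, h]; simp
  have hs : Summable (fourierCoeff F) := by rw [hco]; exact summable_zero
  ext t
  have h1 := has_pointwise_sum_fourier_series_of_summable hs (t : AddCircle (2 * Real.pi))
  rw [hco, hF] at h1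
  simp only [Pi.zero_apply, zero_smul] at h1
  exact h1.unique hasSum_zero

lemma aux_op_zero (A B : Dom →ₗ[ℂ] Dom) (hA : SymmetricOp A) (hB : SymmetricOp B)
    (h : ∀ k, A (auxE k) = B (auxE k)) : A = B := by
  ext1 ψ
  rw [← sub_eq_zero]
  apply aux_zero
  intro k
  have h1 := hA (auxE k) ψ
  have h2 := hB (auxE k) ψ
  rw [h k, h2] at h1
  have : ip (auxE k : ℝ → ℂ) ((A ψ - B ψ : Dom) : ℝ → ℂ) =
      ip (auxE k : ℝ → ℂ) (A ψ : ℝ → ℂ) - ip (auxE k : ℝ → ℂ) (B ψ : ℝ → ℂ) := by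
    unfold ip
    rw [← intervalIntegral.integral_sub]
    · congr 1; funext t; simp [mul_sub]
    all_goals
      apply Continuous.intervalIntegrable
      exact (Complex.continuous_conj.comp (aux_cont _)).mul (aux_cont _)
  rw [this, h1, sub_self]

lemma aux_symm_comp (A : Dom →ₗ[ℂ] Dom) (hA : SymmetricOp A) : SymmetricOp (A ∘ₗ A) := by
  intro φ ψ
  simp only [LinearMap.comp_apply]
  rw [hA, hA]

lemma aux_symm_comp3 (A : Dom →ₗ[ℂ] Dom) (hA : SymmetricOp A) : SymmetricOp (A ∘ₗ A ∘ₗ A) := by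
  intro φ ψ
  simp only [LinearMap.comp_apply]
  rw [hA, hA, hA]

lemma aux_symm_id : SymmetricOp (LinearMap.id) := fun _ _ => rfl

lemma aux_symm_smul (A : Dom →ₗ[ℂ] Dom) (hA : SymmetricOp A) (c : ℝ) :
    SymmetricOp ((c : ℂ) • A) := by
  intro φ ψ
  have h := hA φ ψ
  unfold ip at *
  have h1 : ∀ t, (starRingEnd ℂ) ((((c : ℂ) • A) φ : ℝ → ℂ) t) * (ψ : ℝ → ℂ) t =
    (c : ℂ) * ((starRingEnd ℂ) ((A φ : ℝ → ℂ) t) * (ψ : ℝ → ℂ) t) := by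
    intro t; simp; ring
  have h2 : ∀ t, (starRingEnd ℂ) ((φ : ℝ → ℂ) t) * (((c : ℂ) • A) ψ : ℝ → ℂ) t =
    (c : ℂ) * ((starRingEnd ℂ) ((φ : ℝ → ℂ) t) * (A ψ : ℝ → ℂ) t) := by
    intro t; simp; ring
  simp only [h1, h2, intervalIntegral.integral_const_mul, h]

lemma aux_symm_add (A B : Dom →ₗ[ℂ] Dom) (hA : SymmetricOp A) (hB : SymmetricOp B) :
    SymmetricOp (A + B) := by
  intro φ ψ
  have h := hA φ ψ
  have h' := hB φ ψ
  unfold ip at *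
  have h1 : ∀ t, (starRingEnd ℂ) (((A + B) φ : ℝ → ℂ) t) * (ψ : ℝ → ℂ) t =
    (starRingEnd ℂ) ((A φ : ℝ → ℂ) t) * (ψ : ℝ → ℂ) t +
     (starRingEnd ℂ) ((B φ : ℝ → ℂ) t) * (ψ : ℝ → ℂ) t := by
    intro t; simp; ring
  have h2 : ∀ t, (starRingEnd ℂ) ((φ : ℝ → ℂ) t) * ((A + B) ψ : ℝ → ℂ) t =
    (starRingEnd ℂ) ((φ : ℝ → ℂ) t) * (A ψ : ℝ → ℂ) t +
    (starRingEnd ℂ) ((φ : ℝ → ℂ) t) * (B ψ : ℝ → ℂ) t := by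
    intro t; simp; ring
  simp only [h1, h2]
  rw [intervalIntegral.integral_add, intervalIntegral.integral_add, h, h']
  all_goals
    apply Continuous.intervalIntegrable
    exact (Complex.continuous_conj.comp (aux_cont _)).mul (aux_cont _)

lemma aux_real (A : Dom →ₗ[ℂ] Dom) (hA : SymmetricOp A) (k : ℤ) (x : ℂ)
    (h : A (auxE k) = x • auxE k) : ∃ r : ℝ, x = r := by
  have h1 := hA (auxE k) (auxE k)
  rw [h] at h1
  unfold ip at h1
  have hn : ∀ t : ℝ, (starRingEnd ℂ) ((auxE k : ℝ → ℂ) t) * (auxE k : ℝ → ℂ) t = 1 := by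
    intro t
    rw [auxE_apply, ← Complex.exp_conj, ← Complex.exp_add]
    simp
  have e1 : ∀ t : ℝ, (starRingEnd ℂ) (((x • auxE k : Dom) : ℝ → ℂ) t) * (auxE k : ℝ → ℂ) t =
      (starRingEnd ℂ) x := by
    intro t
    have := hn t
    simp only [SetLike.val_smul, Pi.smul_apply, smul_eq_mul, map_mul]
    linear_combination (starRingEnd ℂ) x * this
  have e2 : ∀ t : ℝ, (starRingEnd ℂ) ((auxE k : ℝ → ℂ) t) * ((x • auxE k : Dom) : ℝ → ℂ) t =
      x := by
    intro t
    have := hn t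
    simp only [SetLike.val_smul, Pi.smul_apply, smul_eq_mul]
    linear_combination x * this
  simp only [e1, e2, intervalIntegral.integral_const, sub_zero] at h1
  have h2 : (starRingEnd ℂ) x = x :=
    smul_right_injective ℂ (Real.two_pi_pos.ne') h1
  exact ⟨x.re, (Complex.conj_eq_iff_re.mp h2).symm⟩

lemma aux_affine (y : ℤ → ℝ) (h : ∀ j, y (j + 1) - 2 * y j + y (j - 1) = 0) (j : ℤ) :
    y j = y 0 + j * (y 1 - y 0) := by
  have hc : ∀ j : ℤ, y (j + 1) - y j = y 1 - y 0 := by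
    intro j
    induction j using Int.induction_on with
    | zero => simp
    | succ i ih =>
      have := h (i + 1)
      rw [add_sub_cancel_right] at this
      linarith
    | pred i ih =>
      have := h (-i)
      rw [sub_add_cancel]
      linarith
  induction j using Int.induction_on with
  | zero => simp
  | succ i ih =>
    have := hc i
    push_cast at *
    linarith
  | pred i ih =>
    have := hc (-i - 1)
    rw [sub_add_cancel] at this
    push_cast at *
    linarith

/-- Von Neumann rule on `V_α`: `ℓ³ + 3αℓ² ∈ V_α` and
`Q(ℓ³ + 3αℓ²) = Q(ℓ)³ + 3α Q(ℓ)² + b′ Q(ℓ) + c′ I` for some reals `b′, c′`. -/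
theorem stmt12 (α ν : ℝ) (Q : V α →ₗ[ℝ] (Dom →ₗ[ℂ] Dom)) (hQ : IsQuant (V α) ν Q) :
    ∃ h3 : fcube α ∈ V α, ∃ b' c' : ℝ,
      Q ⟨fcube α, h3⟩ =
        Q ⟨fell, fell_mem_V α⟩ ∘ₗ Q ⟨fell, fell_mem_V α⟩ ∘ₗ Q ⟨fell, fell_mem_V α⟩ +
          ((3 * α : ℝ) : ℂ) • (Q ⟨fell, fell_mem_V α⟩ ∘ₗ Q ⟨fell, fell_mem_V α⟩) +
          (b' : ℂ) • Q ⟨fell, fell_mem_V α⟩ + (c' : ℂ) • (LinearMap.id : Dom →ₗ[ℂ] Dom) := by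
  have h3 := aux_cube_mem α
  refine ⟨h3, ?_⟩
  set X := Q ⟨fcube α, h3⟩ with hX
  set A := Q ⟨fell, fell_mem_V α⟩ with hA
  set S := Q ⟨fsin, fsin_mem_V α⟩ with hS
  set C := Q ⟨fcos, fcos_mem_V α⟩ with hC
  have dcube : Differentiable ℝ (fcube α) := by unfold fcube; fun_prop
  have dell : Differentiable ℝ fell := by unfold fell; fun_prop
  have dsin : Differentiable ℝ fsin := by unfold fsin; fun_prop
  have dcos : Differentiable ℝ fcos := by unfold fcos; fun_prop
  have hcl : ∀ l : ℝ, deriv (fun l : ℝ => l ^ 3 + 3 * α * l ^ 2) l = 3 * l ^ 2 + 6 * α * l := by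
    intro l
    have := (hasDerivAt_pow 3 l).add ((hasDerivAt_pow 2 l).const_mul (3 * α))
    exact (this.congr_deriv (by norm_num; ring)).deriv
  have hdl : ∀ l : ℝ, deriv (fun l : ℝ => 3 * l ^ 2 + 6 * α * l) l = 6 * l + 6 * α := by
    intro l
    have := ((hasDerivAt_pow 2 l).const_mul 3).add ((hasDerivAt_id l).const_mul (6 * α))
    exact (this.congr_deriv (by norm_num; ring)).deriv
  have b1 : pb (fcube α) fsin = fun p => (3 * p.2 ^ 2 + 6 * α * p.2) * Real.cos p.1 := by
    funext p; simp [pb, pdEll, pdTheta, fcube, fsin, hcl]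
  have b2 : pb (fcube α) fcos = fun p => -((3 * p.2 ^ 2 + 6 * α * p.2) * Real.sin p.1) := by
    funext p; simp [pb, pdEll, pdTheta, fcube, fcos, hcl]
  have b0 : pb (fcube α) fell = 0 := by
    funext p; simp [pb, pdEll, pdTheta, fcube, fell]
  have b11 : pb (pb (fcube α) fsin) fsin =
      fun p => (6 * p.2 + 6 * α) * Real.cos p.1 ^ 2 := by
    rw [b1]; funext p
    simp [pb, pdEll, pdTheta, fsin, deriv_mul_const_field, hdl]; ring
  have b22 : pb (pb (fcube α) fcos) fcos =
      fun p => (6 * p.2 + 6 * α) * Real.sin p.1 ^ 2 := by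
    rw [b2]; funext p
    simp [pb, pdEll, pdTheta, fcos, deriv_mul_const_field, hdl]; ring
  have m0 : pb (fcube α) fell ∈ V α := aux_V_lie h3 (fell_mem_V α) dcube dell
  have m1 : pb (fcube α) fsin ∈ V α := aux_V_lie h3 (fsin_mem_V α) dcube dsin
  have m2 : pb (fcube α) fcos ∈ V α := aux_V_lie h3 (fcos_mem_V α) dcube dcos
  have m11 : pb (pb (fcube α) fsin) fsin ∈ V α :=
    aux_V_lie m1 (fsin_mem_V α) (by rw [b1]; fun_prop) dsin
  have m22 : pb (pb (fcube α) fcos) fcos ∈ V α :=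
    aux_V_lie m2 (fcos_mem_V α) (by rw [b2]; fun_prop) dcos
  have q0 := hQ.map_bracket ⟨_, h3⟩ ⟨_, fell_mem_V α⟩ m0
  have q1 := hQ.map_bracket ⟨_, h3⟩ ⟨_, fsin_mem_V α⟩ m1
  have q2 := hQ.map_bracket ⟨_, h3⟩ ⟨_, fcos_mem_V α⟩ m2
  have q11 := hQ.map_bracket ⟨_, m1⟩ ⟨_, fsin_mem_V α⟩ m11
  have q22 := hQ.map_bracket ⟨_, m2⟩ ⟨_, fcos_mem_V α⟩ m22
  rw [q1] at q11
  rw [q2] at q22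
  rw [← hX, ← hS] at q11
  rw [← hX, ← hC] at q22
  rw [← hX, ← hA] at q0
  have hsum : Q ⟨_, m11⟩ + Q ⟨_, m22⟩ = (6 : ℝ) • A + (6 * α) • (LinearMap.id : Dom →ₗ[ℂ] Dom) := by
    rw [← hQ.map_one (fone_mem_V α), hA, ← map_add, ← map_smul, ← map_smul, ← map_add]
    congr 1
    apply Subtype.ext
    change pb (pb (fcube α) fsin) fsin + pb (pb (fcube α) fcos) fcos =
      (6 : ℝ) • fell + (6 * α) • fone
    rw [b11, b22]
    funext p
    simp [fell, fone]
    linear_combination (6 * p.2 + 6 * α) * Real.sin_sq_add_cos_sq p.1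
  have hcomm : ∀ φ, X (A φ) = A (X φ) := by
    intro φ
    have hz : Q ⟨_, m0⟩ = 0 := by
      rw [← map_zero Q]; congr 1; exact Subtype.ext b0
    rw [hz] at q0
    have := congrArg (fun T => T φ) q0
    have this : Complex.I • (X (A φ) - A (X φ)) = 0 := this.symm
    exact sub_eq_zero.mp ((smul_eq_zero.mp this).resolve_left Complex.I_ne_zero)
  have hAE : ∀ k : ℤ, A (auxE k) = ((k : ℂ) + ν) • auxE k := by
    intro k
    ext t
    rw [hA, hQ.map_ell, auxE_deriv]
    simp only [SetLike.val_smul, Pi.smul_apply, smul_eq_mul]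
    linear_combination (-(k : ℂ) * (auxE k : ℝ → ℂ) t) * Complex.I_mul_I
  have hexp : ∀ (k : ℤ) (t : ℝ), (auxE (k + 1) : ℝ → ℂ) t =
      Complex.exp (t * Complex.I) * (auxE k : ℝ → ℂ) t := by
    intro k t
    rw [auxE_apply, auxE_apply, ← Complex.exp_add]; congr 1; push_cast; ring
  have hexm : ∀ (k : ℤ) (t : ℝ), (auxE (k - 1) : ℝ → ℂ) t =
      Complex.exp (-t * Complex.I) * (auxE k : ℝ → ℂ) t := by
    intro k t
    rw [auxE_apply, auxE_apply, ← Complex.exp_add]; congr 1; push_cast; ring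
  have hCE : ∀ k : ℤ, C (auxE k) = (1 / 2 : ℂ) • auxE (k + 1) + (1 / 2 : ℂ) • auxE (k - 1) := by
    intro k
    ext t
    rw [hC, hQ.map_cos, Complex.ofReal_cos, Complex.cos]
    simp only [Submodule.coe_add, SetLike.val_smul, Pi.add_apply, Pi.smul_apply, smul_eq_mul, hexp, hexm]
    ring
  have hSE : ∀ k : ℤ, S (auxE k) =
      (-Complex.I / 2 : ℂ) • auxE (k + 1) + (Complex.I / 2 : ℂ) • auxE (k - 1) := by
    intro k
    ext t
    rw [hS, hQ.map_sin, Complex.ofReal_sin, Complex.sin]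
    simp only [Submodule.coe_add, SetLike.val_smul, Pi.add_apply, Pi.smul_apply, smul_eq_mul, hexp, hexm]
    ring
  have hXs : SymmetricOp X := hQ.symm _
  have hAs : SymmetricOp A := hQ.symm _
  have hXE : ∀ k : ℤ, ∃ x : ℝ, X (auxE k) = (x : ℂ) • auxE k := by
    intro k
    obtain ⟨c, hc⟩ := aux_eig (X (auxE k)) k (by
      intro t
      have h := hcomm (auxE k)
      rw [hAE, map_smul] at h
      have h' := congrArg (fun φ : Dom => (φ : ℝ → ℂ) t) h
      simp only [hA] at h'
      rw [hQ.map_ell] at h'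
      simp only [SetLike.val_smul, Pi.smul_apply, smul_eq_mul] at h'
      linear_combination (-Complex.I) * h' + (deriv (X (auxE k) : ℝ → ℂ) t) * Complex.I_mul_I)
    obtain ⟨r, hr⟩ := aux_real X hXs k c hc
    exact ⟨r, by rw [hc, hr]⟩
  choose x hx using hXE
  have hrec : ∀ j : ℤ, x (j + 1) - 2 * x j + x (j - 1) = 6 * (j + ν + α) := by
    intro j
    rw [q11, q22] at hsum
    have h := congrArg (fun T => (T (auxE j) : ℝ → ℂ) 0) hsum
    have e0 : ∀ k, (auxE k : ℝ → ℂ) 0 = 1 := by intro k; simp [auxE_apply]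
    simp only [LinearMap.add_apply, LinearMap.smul_apply, LinearMap.sub_apply,
      LinearMap.comp_apply, hCE, hSE, hx, hAE, map_add, map_sub, map_smul, Submodule.coe_smul_of_tower, smul_add, smul_sub,
      Submodule.coe_add, Submodule.coe_sub, SetLike.val_smul, Pi.add_apply, Pi.sub_apply,
      Pi.smul_apply, smul_eq_mul, e0, add_sub_cancel_right, sub_add_cancel,
      LinearMap.id_apply, Complex.real_smul] at h
    have hI := Complex.I_sq
    have hI4 : Complex.I ^ 4 = 1 := Complex.I_pow_four
    have h' : ((x (j + 1) - 2 * x j + x (j - 1) : ℝ) : ℂ) = ((6 * (j + ν + α) : ℝ) : ℂ) := by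
      push_cast
      push_cast at h
      ring_nf at h
      simp only [hI, hI4] at h
      rw [show j + 1 = 1 + j by ring, show j - 1 = -1 + j by ring]
      linear_combination h
    exact_mod_cast h'
  let y : ℤ → ℝ := fun j => x j - ((j + ν) ^ 3 + 3 * α * (j + ν) ^ 2)
  have hy := aux_affine y (by
    intro j
    have := hrec j
    simp only [y]
    push_cast
    linear_combination this)
  refine ⟨y 1 - y 0, y 0 - (y 1 - y 0) * ν, ?_⟩
  apply aux_op_zero
  · exact hXs
  · exact aux_symm_add _ _ (aux_symm_add _ _ (aux_symm_add _ _ (aux_symm_comp3 A hAs)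
      (aux_symm_smul _ (aux_symm_comp A hAs) _)) (aux_symm_smul _ hAs _))
      (aux_symm_smul _ aux_symm_id _)
  · intro k
    have h1 : x k = (k + ν) ^ 3 + 3 * α * (k + ν) ^ 2 + (y 1 - y 0) * (k + ν) +
        (y 0 - (y 1 - y 0) * ν) := by
      have h := hy k
      have h2 : y k = x k - ((k + ν) ^ 3 + 3 * α * (k + ν) ^ 2) := rfl
      linear_combination h - h2
    rw [hx, h1]
    simp only [LinearMap.add_apply, LinearMap.smul_apply, LinearMap.comp_apply, hAE, map_smul,
      LinearMap.id_apply, smul_smul, ← add_smul]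
    congr 1
    push_cast
    ring
end
end
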